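/- arXiv:1009.0912 — 11 statements merged into one kernel-verified Lean document; each statement's English description precedes it below -/
import Mathlib

section
/- For every t > 0 and x ∈ ℝ, the function w(t,x) = (1/(2π)) ∫_ℝ exp(iλ³/3 − λ²t/2 + iλx) dλ is smooth on (0,∞) × ℝ and satisfies the forward heat equation ∂w/∂t (t,x) = (1/2) ∂²w/∂x² (t,x). -/
open MeasureTheory

/-- The integrand of the Airy-heat function at `p = (t, x)`, with an extra factor `l ^ n`. -/
noncomputable def airyHeatIntegrand (n : ℕ) (p : ℝ × ℝ) (l : ℝ) : ℂ :=
  (l : ℂ) ^ n * Complex.exp (Complex.I * (l : ℂ) ^ 3 / 3 - (l : ℂ) ^ 2 * (p.1 : ℂ) / 2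
    + Complex.I * (l : ℂ) * (p.2 : ℂ))

/-- The moments `∫ l ^ n exp(il³/3 − l²t/2 + ilx) dl` of the Airy-heat integrand. -/
noncomputable def airyHeatMoment (n : ℕ) (p : ℝ × ℝ) : ℂ :=
  ∫ l : ℝ, airyHeatIntegrand n p l

/-- The first coordinate of `ℝ × ℝ` as a complex-valued continuous linear map. -/
noncomputable def timeCLM : ℝ × ℝ →L[ℝ] ℂ :=
  Complex.ofRealCLM.comp (ContinuousLinearMap.fst ℝ ℝ ℝ)

/-- The second coordinate of `ℝ × ℝ` as a complex-valued continuous linear map. -/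
noncomputable def spaceCLM : ℝ × ℝ →L[ℝ] ℂ :=
  Complex.ofRealCLM.comp (ContinuousLinearMap.snd ℝ ℝ ℝ)

theorem continuous_airyHeatIntegrand (n : ℕ) (p : ℝ × ℝ) :
    Continuous (airyHeatIntegrand n p) := by
  unfold airyHeatIntegrand
  fun_prop

theorem norm_airyHeatIntegrand (n : ℕ) (p : ℝ × ℝ) (l : ℝ) :
    ‖airyHeatIntegrand n p l‖ = |l| ^ n * Real.exp (-(p.1 / 2) * l ^ 2) := by
  have h : Complex.I * (l : ℂ) ^ 3 / 3 - (l : ℂ) ^ 2 * (p.1 : ℂ) / 2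
      + Complex.I * (l : ℂ) * (p.2 : ℂ)
      = ((-(p.1 / 2) * l ^ 2 : ℝ) : ℂ) + ((l ^ 3 / 3 + l * p.2 : ℝ) : ℂ) * Complex.I := by
    push_cast
    ring
  rw [airyHeatIntegrand, norm_mul, norm_pow, Complex.norm_real, Real.norm_eq_abs, h,
    Complex.exp_add, norm_mul, Complex.norm_exp_ofReal_mul_I, mul_one, ← Complex.ofReal_exp,
    Complex.norm_real, Real.norm_eq_abs, Real.abs_exp]

theorem integrable_abs_pow_mul_exp_neg_mul_sq (n : ℕ) {b : ℝ} (hb : 0 < b) :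
    Integrable fun l : ℝ => |l| ^ n * Real.exp (-b * l ^ 2) := by
  have h := (integrable_rpow_mul_exp_neg_mul_sq hb (s := n)
    (by linarith [(Nat.cast_nonneg n : (0 : ℝ) ≤ n)])).norm
  simpa [Real.rpow_natCast, abs_mul, abs_pow] using h

theorem integrable_airyHeatIntegrand (n : ℕ) {p : ℝ × ℝ} (hp : 0 < p.1) :
    Integrable (airyHeatIntegrand n p) := by
  refine (integrable_abs_pow_mul_exp_neg_mul_sq n (half_pos hp)).mono'
    (continuous_airyHeatIntegrand n p).aestronglyMeasurable (.of_forall fun l => ?_)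
  exact (norm_airyHeatIntegrand n p l).le

theorem hasFDerivAt_airyHeatIntegrand (n : ℕ) (p : ℝ × ℝ) (l : ℝ) :
    HasFDerivAt (fun q => airyHeatIntegrand n q l)
      (airyHeatIntegrand (n + 2) p l • ((-1 / 2 : ℂ) • timeCLM)
        + airyHeatIntegrand (n + 1) p l • (Complex.I • spaceCLM)) p := by
  have h1 : HasFDerivAt (fun q : ℝ × ℝ => (q.1 : ℂ)) timeCLM p := timeCLM.hasFDerivAt
  have h2 : HasFDerivAt (fun q : ℝ × ℝ => (q.2 : ℂ)) spaceCLM p := spaceCLM.hasFDerivAt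
  have h := (((h1.const_mul (-(l : ℂ) ^ 2 / 2)).add
    (h2.const_mul (Complex.I * (l : ℂ)))).const_add (Complex.I * (l : ℂ) ^ 3 / 3)).cexp.const_mul
    ((l : ℂ) ^ n)
  refine (h.congr_of_eventuallyEq (.of_forall fun q => ?_)).congr_fderiv ?_
  · simp only [airyHeatIntegrand, Pi.add_apply]
    ring_nf
  · ext <;> simp [airyHeatIntegrand] <;> ring_nf

theorem hasFDerivAt_airyHeatMoment (n : ℕ) {p : ℝ × ℝ} (hp : 0 < p.1) :
    HasFDerivAt (airyHeatMoment n)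
      (airyHeatMoment (n + 2) p • ((-1 / 2 : ℂ) • timeCLM)
        + airyHeatMoment (n + 1) p • (Complex.I • spaceCLM)) p := by
  have hs : {q : ℝ × ℝ | p.1 / 2 < q.1} ∈ nhds p :=
    (isOpen_lt continuous_const continuous_fst).mem_nhds (half_lt_self hp)
  have hbound (m : ℕ) (q : ℝ × ℝ) (hq : p.1 / 2 < q.1) (l : ℝ)
      (L : ℝ × ℝ →L[ℝ] ℂ) :
      ‖airyHeatIntegrand m q l • L‖ ≤ |l| ^ m * Real.exp (-(p.1 / 4) * l ^ 2) * ‖L‖ := by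
    rw [norm_smul, norm_airyHeatIntegrand]
    have : p.1 / 4 ≤ q.1 / 2 := by linarith
    gcongr
  have hint (m : ℕ) := integrable_airyHeatIntegrand m hp
  have h := hasFDerivAt_integral_of_dominated_of_fderiv_le (μ := volume) (𝕜 := ℝ)
    (F := fun q l => airyHeatIntegrand n q l)
    (F' := fun q l => airyHeatIntegrand (n + 2) q l • ((-1 / 2 : ℂ) • timeCLM)
        + airyHeatIntegrand (n + 1) q l • (Complex.I • spaceCLM))
    (bound := fun l => |l| ^ (n + 2) * Real.exp (-(p.1 / 4) * l ^ 2) * ‖(-1 / 2 : ℂ) • timeCLM‖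
      + |l| ^ (n + 1) * Real.exp (-(p.1 / 4) * l ^ 2) * ‖Complex.I • spaceCLM‖)
    hs (.of_forall fun q => (continuous_airyHeatIntegrand n q).aestronglyMeasurable)
    (hint n)
    (((continuous_airyHeatIntegrand _ p).smul continuous_const).add
      ((continuous_airyHeatIntegrand _ p).smul continuous_const)).aestronglyMeasurable
    (.of_forall fun l q hq => by
      refine (norm_add_le _ _).trans (add_le_add ?_ ?_)
      · exact hbound _ q hq l _
      · exact hbound _ q hq l _)
    (((integrable_abs_pow_mul_exp_neg_mul_sq _ (by linarith)).mul_const _).add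
      ((integrable_abs_pow_mul_exp_neg_mul_sq _ (by linarith)).mul_const _))
    (.of_forall fun l q _ => hasFDerivAt_airyHeatIntegrand n q l)
  rwa [integral_add ((hint _).smul_const _) ((hint _).smul_const _), integral_smul_const,
    integral_smul_const] at h

theorem isOpen_upperHalf : IsOpen (Set.Ioi (0 : ℝ) ×ˢ (Set.univ : Set ℝ)) :=
  isOpen_Ioi.prod isOpen_univ

theorem contDiffOn_airyHeatMoment_nat (k n : ℕ) :
    ContDiffOn ℝ k (airyHeatMoment n) (Set.Ioi (0 : ℝ) ×ˢ Set.univ) := by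
  induction k generalizing n with
  | zero =>
    exact contDiffOn_zero.2 fun p hp =>
      (hasFDerivAt_airyHeatMoment n hp.1).continuousAt.continuousWithinAt
  | succ k ih =>
    push_cast
    rw [contDiffOn_succ_iff_fderiv_of_isOpen isOpen_upperHalf]
    refine ⟨fun p hp =>
      (hasFDerivAt_airyHeatMoment n hp.1).differentiableAt.differentiableWithinAt,
      by simp, ?_⟩
    refine ContDiffOn.congr (((ih (n + 2)).smul contDiffOn_const).add
      ((ih (n + 1)).smul contDiffOn_const)) fun p hp =>
      (hasFDerivAt_airyHeatMoment n hp.1).fderiv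

theorem contDiffOn_airyHeatMoment (n : ℕ) :
    ContDiffOn ℝ (⊤ : ℕ∞) (airyHeatMoment n) (Set.Ioi (0 : ℝ) ×ˢ Set.univ) :=
  contDiffOn_infty.2 fun k => contDiffOn_airyHeatMoment_nat k n

theorem hasDerivAt_airyHeatMoment_time (n : ℕ) {t : ℝ} (ht : 0 < t) (x : ℝ) :
    HasDerivAt (fun s => airyHeatMoment n (s, x)) (-1 / 2 * airyHeatMoment (n + 2) (t, x)) t := by
  have h := (hasFDerivAt_airyHeatMoment n (p := (t, x)) ht).comp_hasDerivAt t
    ((hasDerivAt_id t).prodMk (hasDerivAt_const t x))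
  simpa [Function.comp_def, timeCLM, spaceCLM, mul_comm] using h

theorem hasDerivAt_airyHeatMoment_space (n : ℕ) {t : ℝ} (ht : 0 < t) (x : ℝ) :
    HasDerivAt (fun y => airyHeatMoment n (t, y))
      (Complex.I * airyHeatMoment (n + 1) (t, x)) x := by
  have h := (hasFDerivAt_airyHeatMoment n (p := (t, x)) ht).comp_hasDerivAt x
    ((hasDerivAt_const x t).prodMk (hasDerivAt_id x))
  simpa [Function.comp_def, timeCLM, spaceCLM, mul_comm] using h

/-- The Airy-heat function `w(t,x) = (1/(2π)) ∫ exp(iλ³/3 − λ²t/2 + iλx) dλ` is smooth on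
`(0,∞) × ℝ` and satisfies the forward heat equation `∂w/∂t = (1/2) ∂²w/∂x²` there. -/
theorem stmt_0
    (w : ℝ → ℝ → ℂ)
    (hw : ∀ t x : ℝ, w t x = (1 / (2 * (Real.pi : ℂ))) *
      ∫ l : ℝ, Complex.exp (Complex.I * (l : ℂ) ^ 3 / 3 - (l : ℂ) ^ 2 * (t : ℂ) / 2
        + Complex.I * (l : ℂ) * (x : ℂ))) :
    ContDiffOn ℝ (⊤ : ℕ∞) (fun p : ℝ × ℝ => w p.1 p.2) (Set.Ioi (0 : ℝ) ×ˢ Set.univ) ∧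
      ∀ t : ℝ, 0 < t → ∀ x : ℝ,
        deriv (fun s : ℝ => w s x) t = (1 / 2) * iteratedDeriv 2 (fun y : ℝ => w t y) x := by
  obtain rfl : w = fun t x => 1 / (2 * (Real.pi : ℂ)) * airyHeatMoment 0 (t, x) := by
    funext t x
    simp [hw, airyHeatMoment, airyHeatIntegrand]
  refine ⟨contDiffOn_const.mul (contDiffOn_airyHeatMoment 0), fun t ht x => ?_⟩
  have h1 : deriv (fun y => 1 / (2 * (Real.pi : ℂ)) * airyHeatMoment 0 (t, y))
      = fun y => 1 / (2 * (Real.pi : ℂ)) * (Complex.I * airyHeatMoment 1 (t, y)) :=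
    funext fun y => ((hasDerivAt_airyHeatMoment_space 0 ht y).const_mul _).deriv
  rw [((hasDerivAt_airyHeatMoment_time 0 ht x).const_mul _).deriv, iteratedDeriv_succ,
    iteratedDeriv_one, h1,
    (((hasDerivAt_airyHeatMoment_space 1 ht x).const_mul Complex.I).const_mul _).deriv,
    ← mul_assoc Complex.I, Complex.I_mul_I]
  ring
end

section
/- Let f : ℝ → ℂ be measurable and bounded. Then the function v(t,x) = (1/(2π)) ∫_ℝ f(λ) exp(−λ²t/2 + iλx) dλ, defined for t > 0 and x ∈ ℝ, is differentiable in t, twice differentiable in x, and satisfies the heat equation ∂v/∂t (t,x) = (1/2) ∂²v/∂x² (t,x) for all t > 0 and x ∈ ℝ. -/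
open MeasureTheory

/-- The integrand of the heat-kernel Fourier integral of `f`, multiplied by `(i l) ^ n`. -/
noncomputable def heatIntegrand (f : ℝ → ℂ) (n : ℕ) (t x l : ℝ) : ℂ :=
  (Complex.I * (l : ℂ)) ^ n *
    (f l * Complex.exp (-(l : ℂ) ^ 2 * (t : ℂ) / 2 + Complex.I * (l : ℂ) * (x : ℂ)))

theorem measurable_heatIntegrand {f : ℝ → ℂ} (hf : Measurable f) (n : ℕ) (t x : ℝ) :
    Measurable (heatIntegrand f n t x) := by
  unfold heatIntegrand
  fun_prop

theorem norm_heatIntegrand (f : ℝ → ℂ) (n : ℕ) (t x l : ℝ) :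
    ‖heatIntegrand f n t x l‖ = ‖f l‖ * (|l| ^ n * Real.exp (-(t / 2) * l ^ 2)) := by
  have h : (-(l : ℂ) ^ 2 * (t : ℂ) / 2 + Complex.I * (l : ℂ) * (x : ℂ)) =
      ((-(t / 2) * l ^ 2 : ℝ) : ℂ) + ((l * x : ℝ) : ℂ) * Complex.I := by
    push_cast; ring
  rw [heatIntegrand, h, norm_mul, norm_mul, norm_pow, norm_mul, Complex.norm_I, one_mul,
    Complex.norm_real, Real.norm_eq_abs, Complex.norm_exp, Complex.add_re, Complex.ofReal_re,
    Complex.re_ofReal_mul, Complex.I_re, mul_zero, add_zero]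
  ring

theorem norm_heatIntegrand_le {f : ℝ → ℂ} {M : ℝ} (hM : ∀ l, ‖f l‖ ≤ M) (n : ℕ) {s t : ℝ}
    (hst : s ≤ t) (x l : ℝ) :
    ‖heatIntegrand f n t x l‖ ≤ M * (|l| ^ n * Real.exp (-(s / 2) * l ^ 2)) := by
  rw [norm_heatIntegrand]
  have hM₀ : 0 ≤ M := (norm_nonneg _).trans (hM l)
  gcongr
  exact hM l

theorem integrable_heatIntegrand {f : ℝ → ℂ} (hf : Measurable f) {M : ℝ} (hM : ∀ l, ‖f l‖ ≤ M)
    (n : ℕ) {t : ℝ} (ht : 0 < t) (x : ℝ) : Integrable (heatIntegrand f n t x) :=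
  ((integrable_abs_pow_mul_exp_neg_mul_sq n (half_pos ht)).const_mul M).mono'
    (measurable_heatIntegrand hf n t x).aestronglyMeasurable
    (.of_forall fun l => norm_heatIntegrand_le hM n le_rfl x l)

theorem hasDerivAt_heatIntegrand_space (f : ℝ → ℂ) (n : ℕ) (t x l : ℝ) :
    HasDerivAt (fun y => heatIntegrand f n t y l) (heatIntegrand f (n + 1) t x l) x := by
  have h := ((((Complex.ofRealCLM.hasDerivAt (x := x)).const_mul
    (Complex.I * (l : ℂ))).const_add (-(l : ℂ) ^ 2 * (t : ℂ) / 2)).cexp.const_mul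
      (f l)).const_mul ((Complex.I * (l : ℂ)) ^ n)
  refine h.congr_deriv ?_
  simp only [heatIntegrand, Complex.ofRealCLM_apply, Complex.ofReal_one]
  ring

theorem hasDerivAt_heatIntegrand_time (f : ℝ → ℂ) (n : ℕ) (t x l : ℝ) :
    HasDerivAt (fun s => heatIntegrand f n s x l) (1 / 2 * heatIntegrand f (n + 2) t x l) t := by
  have h := (((((Complex.ofRealCLM.hasDerivAt (x := t)).const_mul
    (-(l : ℂ) ^ 2)).div_const 2).add_const (Complex.I * (l : ℂ) * (x : ℂ))).cexp.const_mul
      (f l)).const_mul ((Complex.I * (l : ℂ)) ^ n)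
  refine h.congr_deriv ?_
  simp only [heatIntegrand, Complex.ofRealCLM_apply, Complex.ofReal_one, pow_add, mul_pow,
    Complex.I_sq]
  ring

theorem hasDerivAt_integral_heatIntegrand_space {f : ℝ → ℂ} (hf : Measurable f) {M : ℝ}
    (hM : ∀ l, ‖f l‖ ≤ M) (n : ℕ) {t : ℝ} (ht : 0 < t) (x : ℝ) :
    HasDerivAt (fun y => ∫ l, heatIntegrand f n t y l) (∫ l, heatIntegrand f (n + 1) t x l) x :=
  (hasDerivAt_integral_of_dominated_loc_of_deriv_le Filter.univ_mem
    (.of_forall fun y => (measurable_heatIntegrand hf n t y).aestronglyMeasurable)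
    (integrable_heatIntegrand hf hM n ht x)
    (measurable_heatIntegrand hf (n + 1) t x).aestronglyMeasurable
    (.of_forall fun l y _ => norm_heatIntegrand_le hM (n + 1) le_rfl y l)
    ((integrable_abs_pow_mul_exp_neg_mul_sq (n + 1) (half_pos ht)).const_mul M)
    (.of_forall fun l y _ => hasDerivAt_heatIntegrand_space f n t y l)).2

theorem hasDerivAt_integral_heatIntegrand_time {f : ℝ → ℂ} (hf : Measurable f) {M : ℝ}
    (hM : ∀ l, ‖f l‖ ≤ M) (n : ℕ) {t : ℝ} (ht : 0 < t) (x : ℝ) :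
    HasDerivAt (fun s => ∫ l, heatIntegrand f n s x l)
      (1 / 2 * ∫ l, heatIntegrand f (n + 2) t x l) t := by
  rw [← integral_const_mul]
  refine (hasDerivAt_integral_of_dominated_loc_of_deriv_le (Ioi_mem_nhds (half_lt_self ht))
    (.of_forall fun s => (measurable_heatIntegrand hf n s x).aestronglyMeasurable)
    (integrable_heatIntegrand hf hM n ht x)
    ((measurable_heatIntegrand hf (n + 2) t x).const_mul _).aestronglyMeasurable
    (.of_forall fun l s hs => ?_)
    ((integrable_abs_pow_mul_exp_neg_mul_sq (n + 2) (half_pos (half_pos ht))).const_mul M)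
    (.of_forall fun l s _ => hasDerivAt_heatIntegrand_time f n s x l)).2
  have h := norm_heatIntegrand_le hM (n + 2) (le_of_lt hs) x l
  have h_half : ‖(1 / 2 : ℂ)‖ = 1 / 2 := by norm_num
  rw [norm_mul, h_half]
  linarith [norm_nonneg (heatIntegrand f (n + 2) s x l)]

/-- For measurable bounded `f : ℝ → ℂ`, the function
`v(t,x) = (1/(2π)) ∫ f(λ) exp(−λ²t/2 + iλx) dλ` is differentiable in `t`, twice
differentiable in `x`, and satisfies the heat equation `∂v/∂t = (1/2) ∂²v/∂x²`
for all `t > 0`, `x ∈ ℝ`. -/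
theorem stmt_1
    (f : ℝ → ℂ) (hf_meas : Measurable f) (hf_bdd : ∃ M : ℝ, ∀ l : ℝ, ‖f l‖ ≤ M)
    (v : ℝ → ℝ → ℂ)
    (hv : ∀ t x : ℝ, v t x = (1 / (2 * (Real.pi : ℂ))) *
      ∫ l : ℝ, f l * Complex.exp (-(l : ℂ) ^ 2 * (t : ℂ) / 2 + Complex.I * (l : ℂ) * (x : ℂ))) :
    ∀ t : ℝ, 0 < t → ∀ x : ℝ,
      DifferentiableAt ℝ (fun s : ℝ => v s x) t ∧
      DifferentiableAt ℝ (fun y : ℝ => v t y) x ∧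
      DifferentiableAt ℝ (deriv (fun y : ℝ => v t y)) x ∧
      deriv (fun s : ℝ => v s x) t = (1 / 2) * iteratedDeriv 2 (fun y : ℝ => v t y) x := by
  obtain ⟨M, hM⟩ := hf_bdd
  intro t ht x
  have hv' : v = fun s y => 1 / (2 * (Real.pi : ℂ)) * ∫ l, heatIntegrand f 0 s y l := by
    ext s y
    simp [hv, heatIntegrand]
  have hspace (n : ℕ) (y : ℝ) :=
    (hasDerivAt_integral_heatIntegrand_space hf_meas hM n ht y).const_mul
      (1 / (2 * (Real.pi : ℂ)))
  have htime := (hasDerivAt_integral_heatIntegrand_time hf_meas hM 0 ht x).const_mul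
    (1 / (2 * (Real.pi : ℂ)))
  have hderiv : deriv (fun y : ℝ => v t y) =
      fun y => 1 / (2 * (Real.pi : ℂ)) * ∫ l, heatIntegrand f 1 t y l := by
    ext y
    rw [hv']
    exact (hspace 0 y).deriv
  refine ⟨?_, ?_, ?_, ?_⟩
  · rw [hv']
    exact htime.differentiableAt
  · rw [hv']
    exact (hspace 0 x).differentiableAt
  · rw [hderiv]
    exact (hspace 1 x).differentiableAt
  · rw [iteratedDeriv_succ, iteratedDeriv_one, hderiv, (hspace 1 x).deriv, hv', htime.deriv]
    ring
end

section
/- For every x ∈ ℝ, the limit lim_{R→∞} (1/(2π)) ∫_{−R}^{R} exp(i(λ³/3 + λx)) dλ exists (as a limit in ℂ; its value is real). This limit defines the Airy function Ai(x). -/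
open MeasureTheory Filter

namespace AiryIntegral

/-- The oscillatory integrand of the Airy function. -/
noncomputable def integrand (x l : ℝ) : ℂ :=
  Complex.exp (Complex.I * ((l : ℂ) ^ 3 / 3 + (l : ℂ) * (x : ℂ)))

/-- The boundary term produced by integrating `integrand x` by parts against `1 / (1 + l ^ 2)`. -/
noncomputable def boundaryTerm (x l : ℝ) : ℂ :=
  -Complex.I * integrand x l / (1 + (l : ℂ) ^ 2)

/-- The absolutely integrable part left after integrating `integrand x` by parts. -/
noncomputable def remainder (x l : ℝ) : ℂ :=
  integrand x l * ((1 - x) / (1 + (l : ℂ) ^ 2) - 2 * Complex.I * l / (1 + (l : ℂ) ^ 2) ^ 2)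

lemma one_add_sq_ne_zero (l : ℝ) : (1 + (l : ℂ) ^ 2) ≠ 0 := by
  exact_mod_cast (by positivity : (1 + l ^ 2 : ℝ) ≠ 0)

lemma norm_one_add_sq (l : ℝ) : ‖(1 + (l : ℂ) ^ 2)‖ = 1 + l ^ 2 := by
  have h := Complex.norm_of_nonneg (by positivity : (0 : ℝ) ≤ 1 + l ^ 2)
  push_cast at h
  exact h

lemma norm_integrand (x l : ℝ) : ‖integrand x l‖ = 1 := by
  have h : Complex.I * ((l : ℂ) ^ 3 / 3 + (l : ℂ) * (x : ℂ)) =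
      ((l ^ 3 / 3 + l * x : ℝ) : ℂ) * Complex.I := by
    push_cast
    ring
  rw [integrand, h, Complex.norm_exp_ofReal_mul_I]

lemma continuous_integrand (x : ℝ) : Continuous (integrand x) := by
  unfold integrand
  fun_prop

lemma continuous_remainder (x : ℝ) : Continuous (remainder x) := by
  have h := continuous_integrand x
  unfold remainder
  refine h.mul (Continuous.sub (Continuous.div (by fun_prop) (by fun_prop) one_add_sq_ne_zero)
    (Continuous.div (by fun_prop) (by fun_prop) fun l => pow_ne_zero 2 (one_add_sq_ne_zero l)))

lemma hasDerivAt_boundaryTerm (x l : ℝ) :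
    HasDerivAt (boundaryTerm x) (integrand x l - remainder x l) l := by
  have hl : HasDerivAt (fun t : ℝ => (t : ℂ)) 1 l := Complex.ofRealCLM.hasDerivAt
  have hE : HasDerivAt (integrand x) _ l :=
    ((((hl.pow 3).div_const 3).add (hl.mul_const (x : ℂ))).const_mul Complex.I).cexp
  have hG : HasDerivAt (boundaryTerm x) _ l :=
    (hE.const_mul (-Complex.I)).div ((hl.pow 2).const_add 1) (one_add_sq_ne_zero l)
  refine hG.congr_deriv ?_
  have h0 := one_add_sq_ne_zero l
  simp only [remainder, integrand, Pi.add_apply, Pi.pow_apply]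
  field_simp
  norm_num
  ring_nf
  simp only [Complex.I_sq]
  ring

lemma norm_remainder_le (x l : ℝ) : ‖remainder x l‖ ≤ (|1 - x| + 1) * (1 + l ^ 2)⁻¹ := by
  have hpos : (0 : ℝ) < 1 + l ^ 2 := by positivity
  have h1 : ‖((1 : ℂ) - x)‖ = |1 - x| := by
    rw [← Complex.ofReal_one, ← Complex.ofReal_sub, Complex.norm_real, Real.norm_eq_abs]
  have h2 : 2 * |l| ≤ 1 + l ^ 2 := by nlinarith [sq_nonneg (|l| - 1), sq_abs l]
  rw [remainder, norm_mul, norm_integrand, one_mul]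
  refine (norm_sub_le _ _).trans ?_
  rw [norm_div, norm_div, norm_pow, norm_one_add_sq, h1, add_mul, one_mul, ← div_eq_mul_inv]
  gcongr
  have h3 : ‖2 * Complex.I * (l : ℂ)‖ = 2 * |l| := by simp
  rw [h3, div_le_iff₀ (by positivity), sq (1 + l ^ 2), inv_mul_cancel_left₀ hpos.ne']
  exact h2

lemma integrable_remainder (x : ℝ) : Integrable (remainder x) :=
  (integrable_inv_one_add_sq.const_mul (|1 - x| + 1)).mono'
    (continuous_remainder x).aestronglyMeasurable
    (Eventually.of_forall (norm_remainder_le x))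

lemma norm_boundaryTerm (x l : ℝ) : ‖boundaryTerm x l‖ = (1 + l ^ 2)⁻¹ := by
  rw [boundaryTerm, norm_div, norm_mul, norm_integrand, norm_one_add_sq]
  simp

lemma tendsto_boundaryTerm_atTop (x : ℝ) : Tendsto (boundaryTerm x) atTop (nhds 0) := by
  rw [tendsto_zero_iff_norm_tendsto_zero]
  simp only [norm_boundaryTerm]
  exact (tendsto_atTop_add_const_left _ _ (tendsto_pow_atTop two_ne_zero)).inv_tendsto_atTop

lemma tendsto_boundaryTerm_neg_atTop (x : ℝ) :
    Tendsto (fun R => boundaryTerm x (-R)) atTop (nhds 0) := by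
  have h := tendsto_zero_iff_norm_tendsto_zero.1 (tendsto_boundaryTerm_atTop x)
  rw [tendsto_zero_iff_norm_tendsto_zero]
  simpa only [norm_boundaryTerm, neg_sq] using h

lemma integral_integrand (x a b : ℝ) :
    ∫ l in a..b, integrand x l =
      boundaryTerm x b - boundaryTerm x a + ∫ l in a..b, remainder x l := by
  have hE := (continuous_integrand x).intervalIntegrable (μ := volume) a b
  have hr := (continuous_remainder x).intervalIntegrable (μ := volume) a b
  rw [← intervalIntegral.integral_eq_sub_of_hasDerivAt
    (fun l _ => hasDerivAt_boundaryTerm x l) (hE.sub hr),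
    intervalIntegral.integral_sub hE hr, sub_add_cancel]

lemma tendsto_integral_integrand (x : ℝ) :
    Tendsto (fun R : ℝ => ∫ l in (-R)..R, integrand x l) atTop (nhds (∫ l, remainder x l)) := by
  simp only [integral_integrand]
  simpa using ((tendsto_boundaryTerm_atTop x).sub (tendsto_boundaryTerm_neg_atTop x)).add
    (intervalIntegral_tendsto_integral (integrable_remainder x) tendsto_neg_atTop_atBot tendsto_id)

end AiryIntegral

/-- For every `x ∈ ℝ`, the improper oscillatory integral
`lim_{R→∞} (1/(2π)) ∫_{−R}^{R} exp(i(λ³/3 + λx)) dλ` exists in `ℂ`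
(this limit defines the Airy function `Ai(x)`). -/
theorem stmt_2 (x : ℝ) :
    ∃ L : ℂ, Tendsto
      (fun R : ℝ => (1 / (2 * (Real.pi : ℂ))) *
        ∫ l : ℝ in (-R)..R, Complex.exp (Complex.I * ((l : ℂ) ^ 3 / 3 + (l : ℂ) * (x : ℂ))))
      atTop (nhds L) :=
  ⟨_, (AiryIntegral.tendsto_integral_integrand x).const_mul _⟩
end

section
/- For every t > 0 and x ∈ ℝ, (1/(2π)) ∫_ℝ exp(iλ³/3 − λ²t/2 + iλx) dλ = exp(t³/12 + t·x/2) · Ai(x + t²/4). -/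
open MeasureTheory Filter

/-- The Airy phase `exp (i (z³/3 + z y))`, as an entire function of `z`. -/
noncomputable def airyKernel (y : ℝ) (z : ℂ) : ℂ :=
  Complex.exp (Complex.I * (z ^ 3 / 3 + z * (y : ℂ)))

lemma differentiable_airyKernel (y : ℝ) : Differentiable ℂ (airyKernel y) := by
  unfold airyKernel
  fun_prop

lemma airyKernel_add_mul_I (y r u : ℝ) :
    airyKernel y (r + u * Complex.I) =
      Complex.exp (((-r ^ 2 * u + u ^ 3 / 3 - y * u : ℝ) : ℂ)
        + ((r ^ 3 / 3 - r * u ^ 2 + r * y : ℝ) : ℂ) * Complex.I) := by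
  unfold airyKernel
  congr 1
  push_cast
  linear_combination (Complex.I ^ 2 * u ^ 3 / 3 + r * u ^ 2 * Complex.I + r ^ 2 * u + u * y
    - u ^ 3 / 3) * Complex.I_sq

lemma norm_airyKernel_add_mul_I (y r u : ℝ) :
    ‖airyKernel y (r + u * Complex.I)‖ = Real.exp (-r ^ 2 * u + u ^ 3 / 3 - y * u) := by
  rw [airyKernel_add_mul_I, Complex.norm_exp]
  congr 1
  simp only [Complex.add_re, Complex.ofReal_re, Complex.re_ofReal_mul, Complex.I_re, mul_zero,
    add_zero]

/-- The integral of the Airy phase over a vertical segment standing on the real axis tends to zero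
as the segment moves off to infinity. -/
lemma tendsto_integral_airyKernel_vertical (y : ℝ) {s : ℝ} (hs : 0 < s) {r : ℝ → ℝ}
    (hr : Tendsto (fun R => r R ^ 2) atTop atTop) :
    Tendsto (fun R => ∫ u : ℝ in (0 : ℝ)..s, airyKernel y (r R + u * Complex.I))
      atTop (nhds 0) := by
  have hlim : Tendsto (fun R => ∫ u : ℝ in (0 : ℝ)..s, airyKernel y (r R + u * Complex.I))
      atTop (nhds (∫ _u : ℝ in (0 : ℝ)..s, (0 : ℂ))) := by
    refine intervalIntegral.tendsto_integral_filter_of_dominated_convergence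
      (fun u => Real.exp (u ^ 3 / 3 - y * u)) ?_ ?_ ?_ ?_
    · refine Eventually.of_forall fun R => Continuous.aestronglyMeasurable ?_
      exact (differentiable_airyKernel y).continuous.comp (by fun_prop)
    · refine Eventually.of_forall fun R => ae_of_all _ fun u hu => ?_
      rw [Set.uIoc_of_le hs.le] at hu
      rw [norm_airyKernel_add_mul_I]
      refine Real.exp_le_exp.mpr ?_
      nlinarith [mul_nonneg (sq_nonneg (r R)) hu.1.le]
    · exact Continuous.intervalIntegrable (by fun_prop) _ _
    · refine ae_of_all _ fun u hu => ?_
      rw [Set.uIoc_of_le hs.le] at hu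
      rw [tendsto_zero_iff_norm_tendsto_zero]
      simp only [norm_airyKernel_add_mul_I]
      refine Real.tendsto_exp_atBot.comp ?_
      have h := tendsto_atBot_add_const_right atTop (u ^ 3 / 3 - y * u)
        (tendsto_neg_atTop_atBot.comp (hr.atTop_mul_const hu.1))
      refine h.congr fun R => ?_
      simp only [Function.comp_apply]
      ring
  simpa using hlim

lemma integrable_airyKernel_horizontal (y : ℝ) {s : ℝ} (hs : 0 < s) :
    Integrable (fun l : ℝ => airyKernel y (l + s * Complex.I)) := by
  refine Integrable.mono' ((integrable_exp_neg_mul_sq hs).mul_const (Real.exp (s ^ 3 / 3 - y * s)))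
    ?_ (ae_of_all _ fun l => ?_)
  · exact ((differentiable_airyKernel y).continuous.comp (by fun_prop)).aestronglyMeasurable
  · rw [norm_airyKernel_add_mul_I, ← Real.exp_add]
    exact le_of_eq (by ring_nf)

/-- Cauchy's theorem on rectangles: the improper integral of the Airy phase along the real axis
equals its absolutely convergent integral along the line `Im z = s`. -/
lemma tendsto_integral_airyKernel (y : ℝ) {s : ℝ} (hs : 0 < s) :
    Tendsto (fun R : ℝ => ∫ l : ℝ in (-R)..R, airyKernel y l) atTop
      (nhds (∫ l : ℝ, airyKernel y (l + s * Complex.I))) := by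
  have hsq : Tendsto (fun R : ℝ => R ^ 2) atTop atTop := tendsto_pow_atTop two_ne_zero
  have hright := tendsto_integral_airyKernel_vertical y hs (r := fun R => R) hsq
  have hleft := tendsto_integral_airyKernel_vertical y hs (r := fun R => -R) (by simp)
  have htop := intervalIntegral_tendsto_integral (integrable_airyKernel_horizontal y hs)
    tendsto_neg_atTop_atBot tendsto_id
  have hsum := (htop.sub (hright.const_mul Complex.I)).add (hleft.const_mul Complex.I)
  simp only [mul_zero, sub_zero, add_zero] at hsum
  refine hsum.congr fun R => ?_
  have hrect := Complex.integral_boundary_rect_eq_zero_of_differentiableOn (airyKernel y)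
    ⟨-R, 0⟩ ⟨R, s⟩ (differentiable_airyKernel y).differentiableOn
  simp only [Complex.ofReal_zero, zero_mul, add_zero, smul_eq_mul] at hrect
  simp only [id]
  linear_combination -hrect

/-- For `t > 0` and `x ∈ ℝ`, the Airy-heat integral equals
`exp(t³/12 + tx/2) · Ai(x + t²/4)`, where `Ai` is the Airy function, defined by
the improper oscillatory integral `Ai(x) = lim_{R→∞} (1/(2π)) ∫_{−R}^{R} exp(i(λ³/3 + λx)) dλ`. -/
theorem stmt_3
    (Ai : ℝ → ℝ)
    (hAi : ∀ x : ℝ, Tendsto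
      (fun R : ℝ => (1 / (2 * (Real.pi : ℂ))) *
        ∫ l : ℝ in (-R)..R, Complex.exp (Complex.I * ((l : ℂ) ^ 3 / 3 + (l : ℂ) * (x : ℂ))))
      atTop (nhds ((Ai x : ℝ) : ℂ)))
    (t : ℝ) (ht : 0 < t) (x : ℝ) :
    (1 / (2 * (Real.pi : ℂ))) *
      ∫ l : ℝ, Complex.exp (Complex.I * (l : ℂ) ^ 3 / 3 - (l : ℂ) ^ 2 * (t : ℂ) / 2
        + Complex.I * (l : ℂ) * (x : ℂ))
    = ((Real.exp (t ^ 3 / 12 + t * x / 2) * Ai (x + t ^ 2 / 4) : ℝ) : ℂ) := by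
  have hAi_eq := tendsto_nhds_unique (hAi (x + t ^ 2 / 4))
    ((tendsto_integral_airyKernel (x + t ^ 2 / 4) (half_pos ht)).const_mul
      (1 / (2 * (Real.pi : ℂ))))
  have hshift : ∀ l : ℝ, Complex.exp (Complex.I * (l : ℂ) ^ 3 / 3 - (l : ℂ) ^ 2 * (t : ℂ) / 2
        + Complex.I * (l : ℂ) * (x : ℂ)) =
      (Real.exp (t ^ 3 / 12 + t * x / 2) : ℂ) *
        airyKernel (x + t ^ 2 / 4) (l + (t / 2 : ℝ) * Complex.I) := by
    intro l
    rw [airyKernel_add_mul_I, Complex.ofReal_exp, ← Complex.exp_add]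
    congr 1
    push_cast
    ring
  simp only [hshift]
  rw [integral_const_mul, Complex.ofReal_mul, hAi_eq]
  ring
end

section
/- For every z ∈ ℝ with z ≠ 0, the series ∑_{n=0}^∞ He_{3n}(0) · zⁿ/n! diverges; in fact the sequence of terms He_{3n}(0) · zⁿ/n! is unbounded, so in particular the family (He_{3n}(0) · zⁿ/n!)_{n∈ℕ} is not summable. -/
open Nat in
theorem factorial_two_mul_mul_factorial_le_doubleFactorial (m : ℕ) :
    (2 * m)! * m ! ≤ (6 * m - 1)‼ := by
  induction m with
  | zero => simp
  | succ m ih =>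
    have hdouble : (6 * (m + 1) - 1)‼ =
        (6 * m + 5) * ((6 * m + 3) * ((6 * m + 1) * (6 * m - 1)‼)) := by
      rw [show 6 * (m + 1) - 1 = 6 * m + 3 + 2 by omega, Nat.doubleFactorial_add_two,
        show 6 * m + 3 = 6 * m + 1 + 2 by omega, Nat.doubleFactorial_add_two,
        Nat.doubleFactorial_add_one]
    have hfactorial : (2 * (m + 1))! * (m + 1)! =
        (2 * m + 2) * ((2 * m + 1) * ((m + 1) * ((2 * m)! * m !))) := by
      rw [show 2 * (m + 1) = 2 * m + 1 + 1 by ring, Nat.factorial_succ (2 * m + 1),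
        Nat.factorial_succ (2 * m), Nat.factorial_succ m]
      ring
    rw [hdouble, hfactorial]
    gcongr <;> omega

open Nat in
theorem abs_aeval_zero_hermite_two_mul (k : ℕ) :
    |Polynomial.aeval (0 : ℝ) (Polynomial.hermite (2 * k))| = ((2 * k - 1)‼ : ℝ) := by
  have hcoeff := Polynomial.coeff_hermite_explicit k 0
  simp only [add_zero, Nat.choose_zero_right, Nat.cast_one, mul_one] at hcoeff
  rw [← Polynomial.coeff_zero_eq_aeval_zero', hcoeff]
  simp [abs_mul]

open Nat in
theorem factorial_mul_pow_le_abs_lacunary_hermite_term (z : ℝ) (m : ℕ) :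
    (m ! : ℝ) * (z ^ 2) ^ m ≤
      |Polynomial.aeval (0 : ℝ) (Polynomial.hermite (3 * (2 * m))) * z ^ (2 * m) /
        ((2 * m)! : ℝ)| := by
  have hle : ((2 * m)! : ℝ) * m ! ≤ ((6 * m - 1)‼ : ℝ) := by
    exact_mod_cast factorial_two_mul_mul_factorial_le_doubleFactorial m
  rw [show 3 * (2 * m) = 2 * (3 * m) by ring, abs_div, abs_mul,
    abs_aeval_zero_hermite_two_mul, show 2 * (3 * m) = 6 * m by ring, pow_mul,
    abs_of_nonneg (by positivity : 0 ≤ (z ^ 2) ^ m), Nat.abs_cast, le_div_iff₀ (by positivity)]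
  calc (m ! : ℝ) * (z ^ 2) ^ m * (2 * m)! = ((2 * m)! * m !) * (z ^ 2) ^ m := by ring
    _ ≤ _ := by gcongr

open Nat in
theorem exists_lt_factorial_mul_pow {x : ℝ} (hx : 0 < x) (C : ℝ) :
    ∃ m : ℕ, C < (m ! : ℝ) * x ^ m := by
  have hlim := FloorSemiring.tendsto_pow_div_factorial_atTop x⁻¹
  obtain ⟨m, hm⟩ := (hlim.eventually_lt_const (by positivity : 0 < (|C| + 1)⁻¹)).exists
  refine ⟨m, ?_⟩
  rw [show x⁻¹ ^ m / (m ! : ℝ) = ((m ! : ℝ) * x ^ m)⁻¹ by rw [inv_pow, mul_inv]; ring,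
    inv_lt_inv₀ (by positivity) (by positivity)] at hm
  linarith [le_abs_self C]

/-- For every real `z ≠ 0`, the terms `He_{3n}(0) zⁿ/n!` of the lacunary Hermite series
are unbounded; in particular the family is not summable (the series diverges). -/
theorem stmt_5 (z : ℝ) (hz : z ≠ 0) :
    (∀ C : ℝ, ∃ n : ℕ,
      C < |(Polynomial.aeval (0 : ℝ) (Polynomial.hermite (3 * n))) * z ^ n / (Nat.factorial n : ℝ)|) ∧
    ¬ Summable (fun n : ℕ =>
      (Polynomial.aeval (0 : ℝ) (Polynomial.hermite (3 * n))) * z ^ n / (Nat.factorial n : ℝ)) := by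
  have hunbounded : ∀ C : ℝ, ∃ n : ℕ,
      C < |(Polynomial.aeval (0 : ℝ) (Polynomial.hermite (3 * n))) * z ^ n /
        (Nat.factorial n : ℝ)| := fun C => by
    obtain ⟨m, hm⟩ := exists_lt_factorial_mul_pow (by positivity : 0 < z ^ 2) C
    exact ⟨2 * m, hm.trans_le (factorial_mul_pow_le_abs_lacunary_hermite_term z m)⟩
  refine ⟨hunbounded, fun hsum => ?_⟩
  obtain ⟨C, hC⟩ := hsum.tendsto_atTop_zero.abs.bddAbove_range
  obtain ⟨n, hn⟩ := hunbounded C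
  exact (hC ⟨n, rfl⟩).not_gt hn
end

section
/- Let n ∈ ℕ with n ≥ 1, let a ∈ ℂ and s ∈ ℝ, and let g : ℝ → ℂ be continuous with compact support. Then the function u(t,x) = (1/(2π)) ∫_ℝ g(λ) · exp{a·(iλ)ⁿ·t − (1/2)·s·λ²·t + iλx} dλ is well defined for all (t,x) ∈ ℝ² and satisfies the partial differential equation ∂u/∂t (t,x) = a · ∂ⁿu/∂xⁿ (t,x) + (1/2)·s · ∂²u/∂x² (t,x), with u(0,x) = (1/(2π)) ∫_ℝ g(λ) e^{iλx} dλ. -/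
open MeasureTheory

/-- A continuous compactly supported amplitude times a continuous exponential is integrable. -/
theorem integrable_mul_cexp_of_hasCompactSupport {h φ : ℝ → ℂ} (hh : Continuous h)
    (hs : HasCompactSupport h) (hφ : Continuous φ) :
    Integrable (fun l : ℝ => h l * Complex.exp (φ l)) :=
  Continuous.integrable_of_hasCompactSupport (by fun_prop) hs.mul_right

/-- Differentiation under the integral sign for exponential integrals with a continuous
compactly supported amplitude. -/
theorem hasDerivAt_integral_mul_cexp {h p q : ℝ → ℂ} (hh : Continuous h)
    (hs : HasCompactSupport h) (hp : Continuous p) (hq : Continuous q) (y₀ : ℝ) :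
    HasDerivAt (fun y : ℝ => ∫ l : ℝ, h l * Complex.exp (p l * y + q l))
      (∫ l : ℝ, h l * p l * Complex.exp (p l * y₀ + q l)) y₀ := by
  refine (hasDerivAt_integral_of_dominated_loc_of_deriv_le
    (F := fun (y : ℝ) (l : ℝ) => h l * Complex.exp (p l * y + q l))
    (F' := fun (y : ℝ) (l : ℝ) => h l * p l * Complex.exp (p l * y + q l))
    (bound := fun l => ‖h l * p l‖ * Real.exp (‖p l‖ * (|y₀| + 1) + ‖q l‖))
    (Metric.ball_mem_nhds y₀ one_pos) (.of_forall fun y => ?_) ?_ ?_ (.of_forall ?_) ?_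
    (.of_forall ?_)).2
  · exact Continuous.aestronglyMeasurable (by fun_prop)
  · exact integrable_mul_cexp_of_hasCompactSupport hh hs (by fun_prop)
  · exact Continuous.aestronglyMeasurable (by fun_prop)
  · intro l y hy
    have hy' : |y| ≤ |y₀| + 1 := by
      rw [Metric.mem_ball, Real.dist_eq] at hy
      linarith [abs_sub_abs_le_abs_sub y y₀]
    rw [norm_mul]
    gcongr
    refine (Complex.norm_exp_le_exp_norm _).trans (Real.exp_le_exp.2 ?_)
    calc ‖p l * y + q l‖ ≤ ‖p l * y‖ + ‖q l‖ := norm_add_le _ _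
      _ = ‖p l‖ * |y| + ‖q l‖ := by rw [norm_mul, Complex.norm_real, Real.norm_eq_abs]
      _ ≤ _ := by gcongr
  · exact Continuous.integrable_of_hasCompactSupport (by fun_prop) hs.mul_right.norm.mul_right
  · intro l y _
    have hlin : HasDerivAt (fun y : ℝ => p l * (y : ℂ) + q l) (p l) y := by
      simpa using ((Complex.ofRealCLM.hasDerivAt (x := y)).const_mul (p l)).add_const (q l)
    exact (hlin.cexp.const_mul (h l)).congr_deriv (by ring)

/-- Iterated derivatives of exponential integrals with a continuous compactly supported
amplitude. -/
theorem iteratedDeriv_integral_mul_cexp {h p q : ℝ → ℂ} (hh : Continuous h)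
    (hs : HasCompactSupport h) (hp : Continuous p) (hq : Continuous q) (k : ℕ) :
    iteratedDeriv k (fun y : ℝ => ∫ l : ℝ, h l * Complex.exp (p l * y + q l)) =
      fun y : ℝ => ∫ l : ℝ, h l * p l ^ k * Complex.exp (p l * y + q l) := by
  induction k with
  | zero => simp
  | succ k ih =>
    rw [iteratedDeriv_succ, ih]
    funext y
    rw [(hasDerivAt_integral_mul_cexp (h := fun l => h l * p l ^ k) (by fun_prop)
      hs.mul_right hp hq y).deriv]
    simp only [pow_succ, mul_assoc]

/-- For `n ≥ 1`, `a ∈ ℂ`, `s ∈ ℝ` and `g : ℝ → ℂ` continuous with compact support, the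
function `u(t,x) = (1/(2π)) ∫ g(λ) exp(a(iλ)ⁿt − sλ²t/2 + iλx) dλ` is well defined
(the integrand is integrable), satisfies `∂u/∂t = a ∂ⁿu/∂xⁿ + (s/2) ∂²u/∂x²`, and has
initial value `u(0,x) = (1/(2π)) ∫ g(λ) e^{iλx} dλ`. -/
theorem stmt_9 (n : ℕ) (hn : 1 ≤ n) (a : ℂ) (s : ℝ)
    (g : ℝ → ℂ) (hg_cont : Continuous g) (hg_supp : HasCompactSupport g)
    (u : ℝ → ℝ → ℂ)
    (hu : ∀ t x : ℝ, u t x = (1 / (2 * (Real.pi : ℂ))) *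
      ∫ l : ℝ, g l * Complex.exp (a * (Complex.I * (l : ℂ)) ^ n * (t : ℂ)
        - (1 / 2) * (s : ℂ) * (l : ℂ) ^ 2 * (t : ℂ) + Complex.I * (l : ℂ) * (x : ℂ))) :
    (∀ t x : ℝ, Integrable (fun l : ℝ =>
        g l * Complex.exp (a * (Complex.I * (l : ℂ)) ^ n * (t : ℂ)
          - (1 / 2) * (s : ℂ) * (l : ℂ) ^ 2 * (t : ℂ) + Complex.I * (l : ℂ) * (x : ℂ)))) ∧
    (∀ t x : ℝ,
      deriv (fun t' : ℝ => u t' x) t =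
        a * iteratedDeriv n (fun x' : ℝ => u t x') x
          + (1 / 2) * (s : ℂ) * iteratedDeriv 2 (fun x' : ℝ => u t x') x) ∧
    (∀ x : ℝ, u 0 x = (1 / (2 * (Real.pi : ℂ))) *
      ∫ l : ℝ, g l * Complex.exp (Complex.I * (l : ℂ) * (x : ℂ))) := by
  refine ⟨fun t x => integrable_mul_cexp_of_hasCompactSupport hg_cont hg_supp (by fun_prop),
    fun t x => ?_, fun x => by simp [hu]⟩
  have hx : ∀ k : ℕ, iteratedDeriv k (fun x' : ℝ => u t x') x = (1 / (2 * (Real.pi : ℂ))) *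
      ∫ l : ℝ, g l * (Complex.I * (l : ℂ)) ^ k *
        Complex.exp (Complex.I * (l : ℂ) * (x : ℂ) + (a * (Complex.I * (l : ℂ)) ^ n * (t : ℂ)
          - (1 / 2) * (s : ℂ) * (l : ℂ) ^ 2 * (t : ℂ))) := by
    intro k
    simp only [hu, iteratedDeriv_const_mul_field]
    congr 1
    rw [← congrFun (iteratedDeriv_integral_mul_cexp (p := fun l : ℝ => Complex.I * (l : ℂ))
      (q := fun l : ℝ => a * (Complex.I * (l : ℂ)) ^ n * (t : ℂ)
        - (1 / 2) * (s : ℂ) * (l : ℂ) ^ 2 * (t : ℂ))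
      hg_cont hg_supp (by fun_prop) (by fun_prop) k) x]
    simp only [add_comm]
  have ht := (hasDerivAt_integral_mul_cexp
    (p := fun l : ℝ => a * (Complex.I * (l : ℂ)) ^ n - (1 / 2) * (s : ℂ) * (l : ℂ) ^ 2)
    (q := fun l : ℝ => Complex.I * (l : ℂ) * (x : ℂ))
    hg_cont hg_supp (by fun_prop) (by fun_prop) t).const_mul (1 / (2 * (Real.pi : ℂ)))
  have hut : (fun t' : ℝ => u t' x) = fun t' : ℝ => (1 / (2 * (Real.pi : ℂ))) *
      ∫ l : ℝ, g l * Complex.exp ((a * (Complex.I * (l : ℂ)) ^ n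
        - (1 / 2) * (s : ℂ) * (l : ℂ) ^ 2) * (t' : ℂ) + Complex.I * (l : ℂ) * (x : ℂ)) := by
    funext t'
    simp only [hu, sub_mul]
  have hint : ∀ k : ℕ, Integrable (fun l : ℝ => g l * (Complex.I * (l : ℂ)) ^ k *
        Complex.exp (Complex.I * (l : ℂ) * (x : ℂ) + (a * (Complex.I * (l : ℂ)) ^ n * (t : ℂ)
          - (1 / 2) * (s : ℂ) * (l : ℂ) ^ 2 * (t : ℂ)))) := fun k =>
    integrable_mul_cexp_of_hasCompactSupport (by fun_prop) hg_supp.mul_right (by fun_prop)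
  rw [hut, ht.deriv, hx, hx, mul_left_comm a, mul_left_comm (1 / 2 * (s : ℂ)), ← mul_add,
    ← integral_const_mul a, ← integral_const_mul (1 / 2 * (s : ℂ)),
    ← integral_add ((hint n).const_mul _) ((hint 2).const_mul _)]
  congr 2
  funext l
  rw [sub_mul, add_comm (_ - _), mul_pow Complex.I _ 2, Complex.I_sq]
  ring
end

section
/- Let m ∈ ℕ be even with m ≥ 2 and let a ∈ ℝ satisfy a·(−1)^{m/2} < 0, and define K(t,x) = (1/(2π)) ∫_ℝ exp{a·(iλ)^m·t + iλx} dλ for t > 0. Then K is smooth on (0,∞) × ℝ and satisfies the higher-order PDE ∂K/∂t (t,x) = a · ∂^m K/∂x^m (t,x) for all t > 0 and x ∈ ℝ. -/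
open MeasureTheory

/-- The integrand `lⁿ exp(c lᵐ t + i l x)` of the `n`-th moment kernel. -/
noncomputable def momentIntegrand (m : ℕ) (c : ℝ) (n : ℕ) (p : ℝ × ℝ) (l : ℝ) : ℂ :=
  (l : ℂ) ^ n * Complex.exp ((c : ℂ) * (l : ℂ) ^ m * (p.1 : ℂ) + Complex.I * (l : ℂ) * (p.2 : ℂ))

/-- The `n`-th moment kernel `∫ lⁿ exp(c lᵐ t + i l x) dl`. -/
noncomputable def momentKernel (m : ℕ) (c : ℝ) (n : ℕ) (p : ℝ × ℝ) : ℂ :=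
  ∫ l : ℝ, momentIntegrand m c n p l

/-- The real-linear map `(t, x) ↦ c t`. -/
noncomputable def timeCovector (c : ℝ) : ℝ × ℝ →L[ℝ] ℂ :=
  (c : ℂ) • (Complex.ofRealCLM.comp (ContinuousLinearMap.fst ℝ ℝ ℝ))

/-- The real-linear map `(t, x) ↦ i x`. -/
noncomputable def spaceCovector : ℝ × ℝ →L[ℝ] ℂ :=
  Complex.I • (Complex.ofRealCLM.comp (ContinuousLinearMap.snd ℝ ℝ ℝ))

lemma norm_momentIntegrand (m : ℕ) (c : ℝ) (n : ℕ) (p : ℝ × ℝ) (l : ℝ) :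
    ‖momentIntegrand m c n p l‖ = |l| ^ n * Real.exp (c * l ^ m * p.1) := by
  have hre : ((c : ℂ) * (l : ℂ) ^ m * (p.1 : ℂ) + Complex.I * (l : ℂ) * (p.2 : ℂ)).re
      = c * l ^ m * p.1 := by
    have h : (c : ℂ) * (l : ℂ) ^ m * (p.1 : ℂ) + Complex.I * (l : ℂ) * (p.2 : ℂ)
        = ((c * l ^ m * p.1 : ℝ) : ℂ) + ((l * p.2 : ℝ) : ℂ) * Complex.I := by
      push_cast; ring
    rw [h, Complex.add_re, Complex.ofReal_re, Complex.re_ofReal_mul, Complex.I_re]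
    ring
  rw [momentIntegrand, norm_mul, norm_pow, Complex.norm_real, Real.norm_eq_abs,
    Complex.norm_exp, hre]

lemma continuous_momentIntegrand (m : ℕ) (c : ℝ) (n : ℕ) (p : ℝ × ℝ) :
    Continuous (momentIntegrand m c n p) := by
  unfold momentIntegrand
  fun_prop

lemma sq_sub_one_le_pow_of_even {m : ℕ} (hm_even : Even m) (hm : 2 ≤ m) (l : ℝ) :
    l ^ 2 - 1 ≤ l ^ m := by
  rw [← hm_even.pow_abs l, ← sq_abs l]
  rcases le_total 1 |l| with h | h
  · linarith [pow_le_pow_right₀ h hm]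
  · have h1 : |l| ^ 2 ≤ 1 := pow_le_one₀ (abs_nonneg l) h
    have h2 : 0 ≤ |l| ^ m := by positivity
    linarith

lemma integrable_abs_pow_mul_exp_neg_mul_pow {m : ℕ} (hm_even : Even m) (hm : 2 ≤ m)
    {b : ℝ} (hb : 0 < b) (n : ℕ) :
    Integrable fun l : ℝ => |l| ^ n * Real.exp (-b * l ^ m) := by
  have hgauss : Integrable fun l : ℝ => l ^ (n : ℝ) * Real.exp (-b * l ^ 2) :=
    integrable_rpow_mul_exp_neg_mul_sq hb (by have : (0 : ℝ) ≤ n := n.cast_nonneg; linarith)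
  refine (hgauss.norm.const_mul (Real.exp b)).mono' (by fun_prop) (ae_of_all _ fun l => ?_)
  rw [norm_mul, Real.norm_eq_abs, Real.norm_eq_abs, abs_pow, abs_abs, Real.abs_exp,
    norm_mul, Real.rpow_natCast, Real.norm_eq_abs, Real.norm_eq_abs, abs_pow, Real.abs_exp,
    mul_left_comm, ← Real.exp_add]
  gcongr
  nlinarith [sq_sub_one_le_pow_of_even hm_even hm l]

lemma integrable_momentIntegrand {m : ℕ} (hm_even : Even m) (hm : 2 ≤ m) {c : ℝ} (hc : c < 0)
    (n : ℕ) {p : ℝ × ℝ} (hp : 0 < p.1) : Integrable (momentIntegrand m c n p) := by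
  refine (integrable_abs_pow_mul_exp_neg_mul_pow hm_even hm
    (mul_pos (neg_pos.2 hc) hp) n).mono'
    (continuous_momentIntegrand m c n p).aestronglyMeasurable (ae_of_all _ fun l => ?_)
  rw [norm_momentIntegrand]
  apply le_of_eq
  ring_nf

lemma hasFDerivAt_momentIntegrand (m : ℕ) (c : ℝ) (n : ℕ) (p : ℝ × ℝ) (l : ℝ) :
    HasFDerivAt (fun q => momentIntegrand m c n q l)
      (momentIntegrand m c (n + m) p l • timeCovector c
        + momentIntegrand m c (n + 1) p l • spaceCovector) p := by
  have h1 : HasFDerivAt (fun q : ℝ × ℝ => (q.1 : ℂ))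
      (Complex.ofRealCLM.comp (ContinuousLinearMap.fst ℝ ℝ ℝ)) p :=
    (Complex.ofRealCLM.comp (ContinuousLinearMap.fst ℝ ℝ ℝ)).hasFDerivAt
  have h2 : HasFDerivAt (fun q : ℝ × ℝ => (q.2 : ℂ))
      (Complex.ofRealCLM.comp (ContinuousLinearMap.snd ℝ ℝ ℝ)) p :=
    (Complex.ofRealCLM.comp (ContinuousLinearMap.snd ℝ ℝ ℝ)).hasFDerivAt
  have h := (((h1.const_mul ((c : ℂ) * (l : ℂ) ^ m)).add
    (h2.const_mul (Complex.I * (l : ℂ)))).cexp).const_mul ((l : ℂ) ^ n)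
  refine h.congr_fderiv ?_
  ext <;> simp [momentIntegrand, timeCovector, spaceCovector] <;> ring

lemma norm_momentIntegrand_le {m : ℕ} (hm_even : Even m) {c : ℝ} (hc : c < 0)
    (n : ℕ) {s : ℝ} {q : ℝ × ℝ} (hq : s ≤ q.1) (l : ℝ) :
    ‖momentIntegrand m c n q l‖ ≤ |l| ^ n * Real.exp (-(-c * s) * l ^ m) := by
  rw [norm_momentIntegrand]
  refine mul_le_mul_of_nonneg_left (Real.exp_le_exp.2 ?_) (by positivity)
  have := mul_le_mul_of_nonneg_left hq (mul_nonneg (neg_pos.2 hc).le (hm_even.pow_nonneg l))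
  linarith

lemma hasFDerivAt_momentKernel {m : ℕ} (hm_even : Even m) (hm : 2 ≤ m) {c : ℝ} (hc : c < 0)
    (n : ℕ) {p : ℝ × ℝ} (hp : 0 < p.1) :
    HasFDerivAt (momentKernel m c n)
      (momentKernel m c (n + m) p • timeCovector c
        + momentKernel m c (n + 1) p • spaceCovector) p := by
  have hb : 0 < -c * (p.1 / 2) := mul_pos (neg_pos.2 hc) (half_pos hp)
  have hs : {q : ℝ × ℝ | p.1 / 2 < q.1} ∈ nhds p :=
    (isOpen_lt continuous_const continuous_fst).mem_nhds (half_lt_self hp)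
  have hbound (k : ℕ) := integrable_abs_pow_mul_exp_neg_mul_pow hm_even hm hb k
  have hint (k : ℕ) := integrable_momentIntegrand hm_even hm hc k hp
  have h := hasFDerivAt_integral_of_dominated_of_fderiv_le (μ := volume)
    (F := fun q l => momentIntegrand m c n q l)
    (F' := fun q l => momentIntegrand m c (n + m) q l • timeCovector c
      + momentIntegrand m c (n + 1) q l • spaceCovector)
    (bound := fun l => |l| ^ (n + m) * Real.exp (-(-c * (p.1 / 2)) * l ^ m) * ‖timeCovector c‖
      + |l| ^ (n + 1) * Real.exp (-(-c * (p.1 / 2)) * l ^ m) * ‖spaceCovector‖)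
    hs
    (Filter.Eventually.of_forall fun q =>
      (continuous_momentIntegrand m c n q).aestronglyMeasurable)
    (hint n)
    (((continuous_momentIntegrand m c (n + m) p).smul continuous_const).add
      ((continuous_momentIntegrand m c (n + 1) p).smul continuous_const)).aestronglyMeasurable
    (ae_of_all _ fun l q hq => by
      refine (norm_add_le _ _).trans ?_
      rw [norm_smul, norm_smul]
      gcongr <;> exact norm_momentIntegrand_le hm_even hc _ (le_of_lt hq) l)
    (((hbound (n + m)).mul_const _).add ((hbound (n + 1)).mul_const _))
    (ae_of_all _ fun l q _ => hasFDerivAt_momentIntegrand m c n q l)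
  rw [integral_add ((hint _).smul_const _) ((hint _).smul_const _), integral_smul_const,
    integral_smul_const] at h
  exact h

lemma contDiffOn_momentKernel {m : ℕ} (hm_even : Even m) (hm : 2 ≤ m) {c : ℝ} (hc : c < 0)
    (k n : ℕ) :
    ContDiffOn ℝ k (momentKernel m c n) (Set.Ioi (0 : ℝ) ×ˢ Set.univ) := by
  have hopen : IsOpen (Set.Ioi (0 : ℝ) ×ˢ (Set.univ : Set ℝ)) := isOpen_Ioi.prod isOpen_univ
  induction k generalizing n with
  | zero =>
    exact contDiffOn_zero.2 fun p hp =>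
      (hasFDerivAt_momentKernel hm_even hm hc n hp.1).continuousAt.continuousWithinAt
  | succ k ih =>
    rw [Nat.cast_succ, contDiffOn_succ_iff_fderiv_of_isOpen hopen]
    refine ⟨fun p hp => (hasFDerivAt_momentKernel hm_even hm hc n
      hp.1).differentiableAt.differentiableWithinAt, by simp, ?_⟩
    exact (((ih (n + m)).smul contDiffOn_const).add ((ih (n + 1)).smul contDiffOn_const)).congr
      fun p hp => (hasFDerivAt_momentKernel hm_even hm hc n hp.1).fderiv

lemma hasDerivAt_momentKernel_time {m : ℕ} (hm_even : Even m) (hm : 2 ≤ m) {c : ℝ}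
    (hc : c < 0) (n : ℕ) {t : ℝ} (ht : 0 < t) (x : ℝ) :
    HasDerivAt (fun s => momentKernel m c n (s, x)) (c * momentKernel m c (n + m) (t, x)) t := by
  have h := (hasFDerivAt_momentKernel hm_even hm hc n (p := (t, x)) ht).comp_hasDerivAt t
    ((hasDerivAt_id t).prodMk (hasDerivAt_const t x))
  refine h.congr_deriv ?_
  simp [timeCovector, spaceCovector, mul_comm]

lemma hasDerivAt_momentKernel_space {m : ℕ} (hm_even : Even m) (hm : 2 ≤ m) {c : ℝ}
    (hc : c < 0) (n : ℕ) {t : ℝ} (ht : 0 < t) (x : ℝ) :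
    HasDerivAt (fun y => momentKernel m c n (t, y))
      (Complex.I * momentKernel m c (n + 1) (t, x)) x := by
  have h := (hasFDerivAt_momentKernel hm_even hm hc n (p := (t, x)) ht).comp_hasDerivAt x
    ((hasDerivAt_const x t).prodMk (hasDerivAt_id x))
  refine h.congr_deriv ?_
  simp [timeCovector, spaceCovector, mul_comm]

lemma iteratedDeriv_momentKernel_space {m : ℕ} (hm_even : Even m) (hm : 2 ≤ m) {c : ℝ}
    (hc : c < 0) {t : ℝ} (ht : 0 < t) (k : ℕ) :
    iteratedDeriv k (fun y => momentKernel m c 0 (t, y))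
      = fun y => Complex.I ^ k * momentKernel m c k (t, y) := by
  induction k with
  | zero => simp
  | succ k ih =>
    rw [iteratedDeriv_succ, ih]
    funext y
    rw [((hasDerivAt_momentKernel_space hm_even hm hc k ht y).const_mul _).deriv]
    ring

lemma I_pow_of_even {m : ℕ} (hm_even : Even m) : Complex.I ^ m = (-1) ^ (m / 2) := by
  rw [← Complex.I_sq, ← pow_mul, Nat.mul_div_cancel' hm_even.two_dvd]

/-- For even `m ≥ 2` and real `a` with `a(−1)^{m/2} < 0`, the higher-order Airy kernel
`K(t,x) = (1/(2π)) ∫ exp(a(iλ)ᵐt + iλx) dλ` is smooth on `(0,∞) × ℝ` and satisfies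
the higher-order PDE `∂K/∂t = a ∂ᵐK/∂xᵐ` there. -/
theorem stmt_12 (m : ℕ) (hm_even : Even m) (hm : 2 ≤ m)
    (a : ℝ) (ha : a * (-1 : ℝ) ^ (m / 2) < 0)
    (K : ℝ → ℝ → ℂ)
    (hK : ∀ t x : ℝ, K t x = (1 / (2 * (Real.pi : ℂ))) *
      ∫ l : ℝ, Complex.exp ((a : ℂ) * (Complex.I * (l : ℂ)) ^ m * (t : ℂ)
        + Complex.I * (l : ℂ) * (x : ℂ))) :
    ContDiffOn ℝ (⊤ : ℕ∞) (fun p : ℝ × ℝ => K p.1 p.2) (Set.Ioi (0 : ℝ) ×ˢ Set.univ) ∧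
      ∀ t : ℝ, 0 < t → ∀ x : ℝ,
        deriv (fun t' : ℝ => K t' x) t
          = (a : ℂ) * iteratedDeriv m (fun x' : ℝ => K t x') x := by
  have hKm (t x : ℝ) : K t x
      = (1 / (2 * (Real.pi : ℂ))) * momentKernel m (a * (-1 : ℝ) ^ (m / 2)) 0 (t, x) := by
    rw [hK, momentKernel]
    congr 2
    funext l
    simp only [momentIntegrand, mul_pow, I_pow_of_even hm_even]
    push_cast
    ring_nf
  simp only [hKm]
  refine ⟨contDiffOn_const.mul
    (contDiffOn_infty.2 fun k => contDiffOn_momentKernel hm_even hm ha k 0), fun t ht x => ?_⟩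
  rw [((hasDerivAt_momentKernel_time hm_even hm ha 0 ht x).const_mul _).deriv,
    iteratedDeriv_const_mul_field, iteratedDeriv_momentKernel_space hm_even hm ha ht,
    I_pow_of_even hm_even, zero_add]
  push_cast
  ring
end

section
/- For every t > 0 and x ∈ ℝ, (1/(2π)) ∫_ℝ exp(iλ³/3 − λ²t/2 + iλx) dλ = ∫_ℝ (2πt)^{−1/2} exp(−y²/(2t)) · Ai(x − y) dy, i.e., the Airy-heat function equals the convolution of the Gaussian heat kernel of variance t with the Airy function. -/
open MeasureTheory Filter

/-- The truncated Airy integral grows at most linearly in `x`, uniformly in the truncation. -/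
lemma norm_truncatedAiry_le (x : ℝ) {R : ℝ} (hR : 0 ≤ R) :
    ‖∫ l : ℝ in (-R)..R, Complex.exp (Complex.I * ((l : ℂ) ^ 3 / 3 + (l : ℂ) * (x : ℂ)))‖
      ≤ 2 + (2 + |x|) * Real.pi := by
  set e : ℝ → ℂ := fun l => Complex.exp (Complex.I * ((l : ℂ) ^ 3 / 3 + (l : ℂ) * (x : ℂ)))
    with he
  have hnorm : ∀ l, ‖e l‖ = 1 := fun l => by
    have h : e l = Complex.exp (((l ^ 3 / 3 + l * x : ℝ) : ℂ) * Complex.I) := by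
      simp only [he]; push_cast; ring_nf
    rw [h, Complex.norm_exp_ofReal_mul_I]
  have hpos : ∀ l : ℝ, (1 + (l : ℂ) ^ 2) ≠ 0 := fun l => by
    have : (1 + l ^ 2 : ℝ) ≠ 0 := by positivity
    exact_mod_cast this
  set F : ℝ → ℂ := fun l => -Complex.I * e l / (1 + (l : ℂ) ^ 2) with hF
  set r : ℝ → ℂ := fun l => e l * ((1 - x) / (1 + (l : ℂ) ^ 2)
    - 2 * Complex.I * l / (1 + (l : ℂ) ^ 2) ^ 2) with hr
  have hec : Continuous e := by fun_prop
  have hrc : Continuous r := by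
    refine hec.mul (Continuous.sub ?_ ?_)
    · exact Continuous.div (by fun_prop) (by fun_prop) hpos
    · exact Continuous.div (by fun_prop) (by fun_prop) fun l => pow_ne_zero 2 (hpos l)
  have hderiv : ∀ l : ℝ, HasDerivAt F (e l - r l) l := fun l => by
    have h0 : HasDerivAt (fun l : ℝ => (l : ℂ)) 1 l := Complex.ofRealCLM.hasDerivAt
    have h1 : HasDerivAt e (e l * (Complex.I * ((l : ℂ) ^ 2 + x))) l := by
      refine ((((h0.pow 3).div_const 3).add (h0.mul_const (x : ℂ))).const_mul
        Complex.I).cexp.congr_deriv ?_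
      simp [he]
    have h2 : HasDerivAt (fun l : ℝ => 1 + (l : ℂ) ^ 2) (2 * (l : ℂ)) l := by
      simpa using (h0.pow 2).const_add 1
    refine ((h1.const_mul (-Complex.I)).div h2 (hpos l)).congr_deriv ?_
    simp only [hr]
    have := hpos l
    field_simp
    ring_nf
    simp only [Complex.I_sq]
    ring
  have h : ∀ l : ℝ, ‖(1 + (l : ℂ) ^ 2)‖ = 1 + l ^ 2 := fun l => by
    have : (1 + (l : ℂ) ^ 2) = ((1 + l ^ 2 : ℝ) : ℂ) := by push_cast; rfl
    rw [this, Complex.norm_real, Real.norm_of_nonneg (by positivity)]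
  have hFR : ∀ l, ‖F l‖ ≤ 1 := fun l => by
    simp only [hF, norm_div, norm_mul, norm_neg, Complex.norm_I, hnorm, h]
    rw [div_le_one (by positivity)]
    nlinarith [sq_nonneg l]
  have hrb : ∀ l : ℝ, ‖r l‖ ≤ (2 + |x|) * (1 + l ^ 2)⁻¹ := fun l => by
    have hx : ‖(1 - x : ℂ)‖ ≤ 1 + |x| := by
      simpa using norm_sub_le (1 : ℂ) (x : ℂ)
    have hp : (0 : ℝ) < 1 + l ^ 2 := by positivity
    have hl : 2 * |l| ≤ 1 + l ^ 2 := by nlinarith [sq_nonneg (|l| - 1), sq_abs l]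
    calc ‖r l‖ ≤ ‖(1 - x : ℂ)‖ / (1 + l ^ 2) + 2 * |l| / (1 + l ^ 2) ^ 2 := by
          simp only [hr, norm_mul, hnorm, one_mul]
          refine (norm_sub_le _ _).trans_eq ?_
          simp [h]
      _ ≤ (1 + |x|) / (1 + l ^ 2) + (1 + l ^ 2) / (1 + l ^ 2) ^ 2 := by gcongr
      _ = (2 + |x|) * (1 + l ^ 2)⁻¹ := by field_simp; ring
  have hsub : Continuous fun l => e l - r l := hec.sub hrc
  have hint : ∫ l in (-R)..R, e l = (F R - F (-R)) + ∫ l in (-R)..R, r l := by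
    rw [← intervalIntegral.integral_eq_sub_of_hasDerivAt (fun l _ => hderiv l)
      (hsub.intervalIntegrable _ _),
      ← intervalIntegral.integral_add (hsub.intervalIntegrable _ _)
        (hrc.intervalIntegrable _ _)]
    simp
  have hrint : ‖∫ l in (-R)..R, r l‖ ≤ (2 + |x|) * Real.pi := by
    rw [intervalIntegral.integral_of_le (by linarith), ← integral_univ_inv_one_add_sq,
      ← integral_const_mul]
    have hi : Integrable fun l : ℝ => (2 + |x|) * (1 + l ^ 2)⁻¹ :=
      integrable_inv_one_add_sq.const_mul _
    refine (norm_integral_le_of_norm_le hi.integrableOn (ae_of_all _ hrb)).trans ?_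
    exact setIntegral_le_integral hi (ae_of_all _ fun l => by positivity)
  rw [hint]
  have h1 := norm_add_le (F R - F (-R)) (∫ l in (-R)..R, r l)
  have h2 := norm_sub_le (F R) (F (-R))
  linarith [hFR R, hFR (-R)]

/-- The characteristic function of the centred Gaussian density of variance `t`. -/
lemma integral_heatKernel_mul_cexp {t : ℝ} (ht : 0 < t) (l : ℝ) :
    ∫ y : ℝ, (((2 * Real.pi * t) ^ (-(1 : ℝ) / 2) * Real.exp (-y ^ 2 / (2 * t)) : ℝ) : ℂ)
      * Complex.exp (-(Complex.I * l * y)) = Complex.exp (-((l : ℂ) ^ 2 * t / 2)) := by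
  have ht' : (t : ℂ) ≠ 0 := by exact_mod_cast ht.ne'
  have hb : 0 < (1 / (2 * t : ℂ)).re := by
    have : (1 / (2 * t : ℂ)) = ((1 / (2 * t) : ℝ) : ℂ) := by push_cast; rfl
    rw [this, Complex.ofReal_re]; positivity
  have h := fourierIntegral_gaussian hb (-(l : ℂ))
  have hp : (0 : ℝ) < 2 * Real.pi * t := by positivity
  have hc : ((Real.pi : ℂ) / (1 / (2 * t : ℂ))) ^ (1 / 2 : ℂ)
      = (((2 * Real.pi * t) ^ (1 / 2 : ℝ) : ℝ) : ℂ) := by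
    rw [Complex.ofReal_cpow hp.le]
    push_cast
    congr 1
    field_simp
  rw [hc] at h
  have hcancel : (2 * Real.pi * t) ^ (-(1 : ℝ) / 2) * (2 * Real.pi * t) ^ (1 / 2 : ℝ) = 1 := by
    rw [← Real.rpow_add hp]; norm_num
  calc _ = (((2 * Real.pi * t) ^ (-(1 : ℝ) / 2) : ℝ) : ℂ) *
        ∫ y : ℝ, Complex.exp (Complex.I * (-(l : ℂ)) * y)
          * Complex.exp (-(1 / (2 * t : ℂ)) * (y : ℂ) ^ 2) := by
        rw [← integral_const_mul]
        congr 1 with y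
        push_cast
        rw [mul_assoc, mul_comm (Complex.exp (-(y : ℂ) ^ 2 / _))]
        congr 3 <;> ring_nf
    _ = _ := by
        rw [h, ← mul_assoc, ← Complex.ofReal_mul, hcancel, Complex.ofReal_one, one_mul]
        congr 1
        field_simp
        ring

/-- For `t > 0` and `x ∈ ℝ`, the Airy-heat function
`(1/(2π)) ∫ exp(iλ³/3 − λ²t/2 + iλx) dλ` equals the convolution
`∫ (2πt)^{−1/2} e^{−y²/(2t)} Ai(x − y) dy` of the Gaussian heat kernel of variance `t`
with the Airy function `Ai`, defined by the improper oscillatory integral. -/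
theorem stmt_14
    (Ai : ℝ → ℝ)
    (hAi : ∀ x : ℝ, Tendsto
      (fun R : ℝ => (1 / (2 * (Real.pi : ℂ))) *
        ∫ l : ℝ in (-R)..R, Complex.exp (Complex.I * ((l : ℂ) ^ 3 / 3 + (l : ℂ) * (x : ℂ))))
      atTop (nhds ((Ai x : ℝ) : ℂ)))
    (t : ℝ) (ht : 0 < t) (x : ℝ) :
    (1 / (2 * (Real.pi : ℂ))) *
      ∫ l : ℝ, Complex.exp (Complex.I * (l : ℂ) ^ 3 / 3 - (l : ℂ) ^ 2 * (t : ℂ) / 2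
        + Complex.I * (l : ℂ) * (x : ℂ))
    = (((∫ y : ℝ, (2 * Real.pi * t) ^ (-(1 : ℝ)/2) * Real.exp (-y ^ 2 / (2 * t))
        * Ai (x - y)) : ℝ) : ℂ) := by
  set G : ℝ → ℝ := fun y => (2 * Real.pi * t) ^ (-(1 : ℝ)/2) * Real.exp (-y ^ 2 / (2 * t))
    with hG
  set e : ℝ → ℝ → ℂ := fun z l =>
    Complex.exp (Complex.I * ((l : ℂ) ^ 3 / 3 + (l : ℂ) * (z : ℂ))) with he
  have hGc : Continuous G := by fun_prop
  have hG0 : ∀ y, 0 ≤ G y := fun y => by positivity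
  have hb : 0 < 1 / (2 * t) := by positivity
  have hexp : ∀ y : ℝ, Real.exp (-y ^ 2 / (2 * t)) = Real.exp (-(1 / (2 * t)) * y ^ 2) :=
    fun y => by congr 1; ring
  have hGi : Integrable G := by
    simp only [hG, hexp]
    exact (integrable_exp_neg_mul_sq hb).const_mul _
  have hGyi : Integrable fun y => G y * |y| := by
    have h := ((integrable_mul_exp_neg_mul_sq hb).norm).const_mul
      ((2 * Real.pi * t) ^ (-(1 : ℝ)/2))
    refine h.congr (ae_of_all _ fun y => ?_)
    simp only [hG, hexp, norm_mul, Real.norm_eq_abs, Real.abs_exp]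
    ring
  have hec : Continuous fun p : ℝ × ℝ => e p.1 p.2 := by fun_prop
  have hnorm : ∀ z l, ‖e z l‖ = 1 := fun z l => by
    have h : e z l = Complex.exp (((l ^ 3 / 3 + l * z : ℝ) : ℂ) * Complex.I) := by
      simp only [he]; push_cast; ring_nf
    rw [h, Complex.norm_exp_ofReal_mul_I]
  have hconv : Tendsto (fun R : ℝ => ∫ y, (G y : ℂ) * ((1 / (2 * (Real.pi : ℂ))) *
      ∫ l in (-R)..R, e (x - y) l)) atTop (nhds (∫ y, (G y : ℂ) * (Ai (x - y) : ℂ))) := by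
    refine tendsto_integral_filter_of_dominated_convergence
      (fun y => ‖(1 / (2 * (Real.pi : ℂ)))‖ *
        ((2 + (2 + |x|) * Real.pi) * G y + Real.pi * (G y * |y|)))
      (Eventually.of_forall fun R => ?_) ?_
      (((hGi.const_mul _).add (hGyi.const_mul _)).const_mul _)
      (ae_of_all _ fun y => (hAi (x - y)).const_mul _)
    · refine Continuous.aestronglyMeasurable ?_
      have : Continuous fun y => ∫ l in (-R)..R, e (x - y) l :=
        intervalIntegral.continuous_parametric_intervalIntegral_of_continuous' (by fun_prop) _ _
      fun_prop
    · filter_upwards [eventually_ge_atTop 0] with R hR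
      refine ae_of_all _ fun y => ?_
      have h1 := norm_truncatedAiry_le (x - y) hR
      have h2 : |x - y| ≤ |x| + |y| := abs_sub x y
      rw [norm_mul, norm_mul, Complex.norm_real, Real.norm_of_nonneg (hG0 y)]
      calc _ ≤ G y * (‖(1 / (2 * (Real.pi : ℂ)))‖ * (2 + (2 + (|x| + |y|)) * Real.pi)) := by
            refine mul_le_mul_of_nonneg_left (mul_le_mul_of_nonneg_left (h1.trans ?_)
              (norm_nonneg _)) (hG0 y)
            gcongr
        _ = _ := by ring
  have hswap : ∀ R : ℝ, 0 ≤ R → ∫ y, (G y : ℂ) * ((1 / (2 * (Real.pi : ℂ))) *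
      ∫ l in (-R)..R, e (x - y) l) = (1 / (2 * (Real.pi : ℂ))) *
      ∫ l in (-R)..R, Complex.exp (Complex.I * (l : ℂ) ^ 3 / 3 - (l : ℂ) ^ 2 * (t : ℂ) / 2
        + Complex.I * (l : ℂ) * (x : ℂ)) := fun R hR => by
    have hR' : -R ≤ R := by linarith
    simp only [intervalIntegral.integral_of_le hR']
    have hprod : Integrable (Function.uncurry fun y l => (G y : ℂ) * e (x - y) l)
        (volume.prod (volume.restrict (Set.Ioc (-R) R))) := by
      have hbase : Integrable (fun p : ℝ × ℝ => (G p.1 : ℂ) * (1 : ℂ))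
          (volume.prod (volume.restrict (Set.Ioc (-R) R))) :=
        Integrable.mul_prod (f := fun y => (G y : ℂ)) (g := fun _ => (1 : ℂ))
          hGi.ofReal (integrable_const _)
      refine hbase.mono (Continuous.aestronglyMeasurable (by fun_prop)) (ae_of_all _ fun p => ?_)
      simp [Function.uncurry, hnorm]
    calc _ = (1 / (2 * (Real.pi : ℂ))) *
          ∫ y, ∫ l in Set.Ioc (-R) R, (G y : ℂ) * e (x - y) l := by
          rw [← integral_const_mul]
          congr 1 with y
          rw [integral_const_mul]
          ring
      _ = _ := by
          rw [integral_integral_swap hprod]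
          congr 2 with l
          have hchar := integral_heatKernel_mul_cexp ht l
          calc _ = e x l * ∫ y, (G y : ℂ) * Complex.exp (-(Complex.I * l * y)) := by
                rw [← integral_const_mul]
                congr 1 with y
                rw [mul_left_comm]
                simp only [he, ← Complex.exp_add]
                push_cast
                ring_nf
            _ = _ := by
                rw [hchar]
                simp only [he, ← Complex.exp_add]
                ring_nf
  have hwi : Integrable fun l : ℝ => Complex.exp (Complex.I * (l : ℂ) ^ 3 / 3
      - (l : ℂ) ^ 2 * (t : ℂ) / 2 + Complex.I * (l : ℂ) * (x : ℂ)) := by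
    refine (integrable_exp_neg_mul_sq (half_pos ht)).mono
      (Continuous.aestronglyMeasurable (by fun_prop)) (ae_of_all _ fun l => le_of_eq ?_)
    have h : Complex.exp (Complex.I * (l : ℂ) ^ 3 / 3
        - (l : ℂ) ^ 2 * (t : ℂ) / 2 + Complex.I * (l : ℂ) * (x : ℂ))
        = e x l * ((Real.exp (-(t / 2) * l ^ 2) : ℝ) : ℂ) := by
      push_cast
      simp only [he, ← Complex.exp_add]
      ring_nf
    rw [h, norm_mul, hnorm, one_mul, Complex.norm_real]
  have hw := (intervalIntegral_tendsto_integral hwi tendsto_neg_atTop_atBot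
    tendsto_id).const_mul (1 / (2 * (Real.pi : ℂ)))
  rw [← integral_complex_ofReal]
  push_cast
  refine tendsto_nhds_unique hw (Tendsto.congr' ?_ (by simpa [hG] using hconv))
  filter_upwards [eventually_ge_atTop 0] with R hR
  simpa [hG] using hswap R hR
end

section
/- Let n ∈ ℕ with n ≥ 1 and j ∈ ℕ. Define the higher-order Hermite polynomial H^{(n)}_j(t,x) = j! · ∑_{k=0}^{⌊j/n⌋} x^{j−nk} t^k / ((j−nk)! k!). Then H^{(n)}_j satisfies ∂H^{(n)}_j/∂t (t,x) = ∂ⁿ H^{(n)}_j/∂xⁿ (t,x) for all (t,x) ∈ ℝ², and H^{(n)}_j(0,x) = x^j for all x ∈ ℝ; i.e., H^{(n)}_j solves the Cauchy problem for the higher-order heat equation ∂u/∂t = ∂ⁿu/∂xⁿ with initial data x^j. -/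
/-- The `n`-th derivative of the normalized monomial `x ^ (m + n) / (m + n)!` is `x ^ m / m!`. -/
theorem iteratedDeriv_pow_div_factorial (m n : ℕ) (x : ℝ) :
    iteratedDeriv n (fun y : ℝ => y ^ (m + n)) x / (Nat.factorial (m + n) : ℝ)
      = x ^ m / (Nat.factorial m : ℝ) := by
  have h := Nat.factorial_mul_descFactorial (Nat.le_add_left n m)
  rw [Nat.add_sub_cancel] at h
  have hm : (Nat.factorial m : ℝ) ≠ 0 := by positivity
  have hmn : (Nat.factorial (m + n) : ℝ) ≠ 0 := by positivity
  rw [iteratedDeriv_pow, Nat.add_sub_cancel, div_eq_div_iff hmn hm, ← h]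
  push_cast
  ring

/-- For `n ≥ 1` and `j ∈ ℕ`, the higher-order Hermite polynomial
`H^{(n)}_j(t,x) = j! ∑_{k=0}^{⌊j/n⌋} x^{j−nk} tᵏ/((j−nk)! k!)` satisfies
`∂H/∂t = ∂ⁿH/∂xⁿ` on `ℝ²` and `H(0,x) = xʲ`: it solves the Cauchy problem for the
higher-order heat equation `∂u/∂t = ∂ⁿu/∂xⁿ` with initial data `xʲ`. -/
theorem stmt_15 (n : ℕ) (hn : 1 ≤ n) (j : ℕ)
    (H : ℝ → ℝ → ℝ)
    (hH : ∀ t x : ℝ, H t x = (Nat.factorial j : ℝ) *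
      ∑ k ∈ Finset.range (j / n + 1),
        x ^ (j - n * k) * t ^ k
          / ((Nat.factorial (j - n * k) : ℝ) * (Nat.factorial k : ℝ))) :
    (∀ t x : ℝ,
      deriv (fun t' : ℝ => H t' x) t = iteratedDeriv n (fun x' : ℝ => H t x') x) ∧
    (∀ x : ℝ, H 0 x = x ^ j) := by
  simp only [hH]
  refine ⟨fun t x => ?_, fun x => ?_⟩
  · have hx : iteratedDeriv n (fun x' : ℝ => (Nat.factorial j : ℝ) *
        ∑ k ∈ Finset.range (j / n + 1), x' ^ (j - n * k) * t ^ k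
          / ((Nat.factorial (j - n * k) : ℝ) * (Nat.factorial k : ℝ))) x
        = (Nat.factorial j : ℝ) * ∑ k ∈ Finset.range (j / n + 1),
          t ^ k / (Nat.factorial k : ℝ) * (iteratedDeriv n (fun y : ℝ => y ^ (j - n * k)) x
            / (Nat.factorial (j - n * k) : ℝ)) := by
      rw [iteratedDeriv_const_mul_field, iteratedDeriv_fun_sum fun k _ => by fun_prop]
      congr 1
      refine Finset.sum_congr rfl fun k _ => ?_
      have hfun : (fun x' : ℝ => x' ^ (j - n * k) * t ^ k
          / ((Nat.factorial (j - n * k) : ℝ) * (Nat.factorial k : ℝ)))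
          = fun x' : ℝ => t ^ k / (Nat.factorial k : ℝ) / (Nat.factorial (j - n * k) : ℝ)
            * x' ^ (j - n * k) := by
        ext y
        field_simp
      rw [hfun, iteratedDeriv_const_mul_field]
      ring
    have ht : deriv (fun t' : ℝ => (Nat.factorial j : ℝ) *
        ∑ k ∈ Finset.range (j / n + 1), x ^ (j - n * k) * t' ^ k
          / ((Nat.factorial (j - n * k) : ℝ) * (Nat.factorial k : ℝ))) t
        = (Nat.factorial j : ℝ) * ∑ k ∈ Finset.range (j / n + 1),
          x ^ (j - n * k) * (k * t ^ (k - 1))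
            / ((Nat.factorial (j - n * k) : ℝ) * (Nat.factorial k : ℝ)) :=
      ((HasDerivAt.fun_sum fun k _ =>
        ((hasDerivAt_pow k t).const_mul _).div_const _).const_mul _).deriv
    have hlast : j - n * (j / n) < n := by
      have := Nat.mod_lt j hn
      have := Nat.mod_add_div j n
      omega
    rw [hx, ht, Finset.sum_range_succ', Finset.sum_range_succ]
    congr 1
    rw [iteratedDeriv_pow, Nat.descFactorial_of_lt hlast]
    simp only [Nat.cast_zero, zero_mul, mul_zero, zero_div, add_zero]
    refine Finset.sum_congr rfl fun k hk => ?_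
    have hle : n * (k + 1) ≤ j :=
      (Nat.mul_le_mul_left n (Finset.mem_range.mp hk)).trans (Nat.mul_div_le j n)
    have hsub : j - n * k = j - n * (k + 1) + n := by
      rw [Nat.mul_succ] at hle ⊢
      omega
    rw [hsub, iteratedDeriv_pow_div_factorial, Nat.factorial_succ, Nat.add_sub_cancel]
    push_cast
    field_simp
  · rw [Finset.sum_range_succ', Finset.sum_eq_zero fun k _ => by simp]
    have : (Nat.factorial j : ℝ) ≠ 0 := by positivity
    simp
    field_simp
end

section
/- Let m ∈ ℕ be even with m ≥ 2, let a ∈ ℝ satisfy a·(−1)^{m/2} < 0, and define K(t,x) = (1/(2π)) ∫_ℝ exp{a·(iλ)^m·t + iλx} dλ for t > 0. Then for every j ∈ ℕ, t > 0 and x ∈ ℝ, the function y ↦ y^j · K(t, x − y) is Lebesgue integrable on ℝ and ∫_ℝ K(t, x − y) · y^j dy = j! · ∑_{k=0}^{⌊j/m⌋} x^{j−mk} (a t)^k / ((j−mk)! k!) = H^{(m)}_j(at, x). In other words, convolving the higher-order kernel K(t,·) with the monomial x^j produces the higher-order Hermite polynomial H^{(m)}_j evaluated at (at, x). -/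
open MeasureTheory
open scoped FourierTransform SchwartzMap

/-- The power series expansion of `s ↦ exp (B s ^ m + y s)` along the real line. -/
lemma hasSum_cexp_mul_pow_add (m : ℕ) (hm : 0 < m) (B y : ℂ) (s : ℝ) :
    HasSum (fun j : ℕ => s ^ j • ∑ k ∈ Finset.range (j / m + 1),
        y ^ (j - m * k) * B ^ k / ((Nat.factorial (j - m * k) : ℂ) * (Nat.factorial k : ℂ)))
      (Complex.exp (B * (s : ℂ) ^ m + y * (s : ℂ))) := by
  have hexp (z : ℂ) : HasSum (fun n : ℕ => z ^ n / (Nat.factorial n : ℂ)) (Complex.exp z) := by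
    rw [Complex.exp_eq_exp_ℂ]
    exact NormedSpace.expSeries_div_hasSum_exp z
  have hnorm (z : ℂ) : Summable fun n : ℕ => ‖z ^ n / (Nat.factorial n : ℂ)‖ :=
    NormedSpace.norm_expSeries_div_summable z
  have hmul {f g : ℕ → ℂ} {u v : ℂ} (hf : HasSum f u) (hg : HasSum g v)
      (hf' : Summable fun n => ‖f n‖) (hg' : Summable fun n => ‖g n‖) :
      HasSum (fun p : ℕ × ℕ => f p.1 * g p.2) (u * v) :=
    hf.mul hg (summable_mul_of_summable_norm hf' hg')
  have hprod := hmul (hexp (B * (s : ℂ) ^ m)) (hexp (y * s)) (hnorm _) (hnorm _)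
  rw [← Complex.exp_add] at hprod
  set term : ℕ × ℕ → ℂ := fun p => if m * p.2 ≤ p.1 then
    (s : ℂ) ^ p.1 * (y ^ (p.1 - m * p.2) * B ^ p.2 /
      ((Nat.factorial (p.1 - m * p.2) : ℂ) * (Nat.factorial p.2 : ℂ))) else 0 with hterm
  have hinj : Function.Injective (fun p : ℕ × ℕ => (m * p.1 + p.2, p.1)) := by
    rintro ⟨k, l⟩ ⟨k', l'⟩ h
    simp only [Prod.mk.injEq] at h
    obtain ⟨h, rfl⟩ := h
    simpa using h
  have hreindex : HasSum term (Complex.exp (B * (s : ℂ) ^ m + y * (s : ℂ))) := by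
    rw [← hinj.hasSum_iff]
    · convert hprod using 1
      ext ⟨k, l⟩
      simp only [hterm, Function.comp_apply, Nat.le_add_right, if_true, Nat.add_sub_cancel_left]
      rw [mul_pow, mul_pow, ← pow_mul, pow_add]
      field_simp
    · rintro ⟨j, k⟩ hjk
      simp only [hterm, ite_eq_right_iff]
      intro h
      exact absurd ⟨(k, j - m * k), by simp [Nat.add_sub_cancel' h]⟩ hjk
  have hfiber (j : ℕ) : HasSum (fun k => term (j, k))
      (s ^ j • ∑ k ∈ Finset.range (j / m + 1), y ^ (j - m * k) * B ^ k /
        ((Nat.factorial (j - m * k) : ℂ) * (Nat.factorial k : ℂ))) := by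
    have hle {k : ℕ} : k ∈ Finset.range (j / m + 1) ↔ m * k ≤ j := by
      rw [Finset.mem_range, Nat.lt_succ_iff, Nat.le_div_iff_mul_le hm, mul_comm]
    have hsum : HasSum (fun k => term (j, k)) (∑ k ∈ Finset.range (j / m + 1), term (j, k)) :=
      hasSum_sum_of_ne_finset_zero fun k hk => if_neg (mt hle.mpr hk)
    convert hsum using 1
    rw [Finset.smul_sum]
    refine Finset.sum_congr rfl fun k hk => ?_
    simp [hterm, hle.mp hk]
  exact hreindex.prod_fiberwise hfiber

lemma iteratedDeriv_cexp_mul_pow_add_zero (m : ℕ) (hm : 0 < m) (B y : ℂ) (j : ℕ) :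
    iteratedDeriv j (fun s : ℝ => Complex.exp (B * (s : ℂ) ^ m + y * (s : ℂ))) 0 =
      (Nat.factorial j : ℂ) * ∑ k ∈ Finset.range (j / m + 1),
        y ^ (j - m * k) * B ^ k / ((Nat.factorial (j - m * k) : ℂ) * (Nat.factorial k : ℂ)) := by
  set c : ℕ → ℂ := fun j => ∑ k ∈ Finset.range (j / m + 1),
    y ^ (j - m * k) * B ^ k / ((Nat.factorial (j - m * k) : ℂ) * (Nat.factorial k : ℂ))
  let p : FormalMultilinearSeries ℝ ℝ ℂ := fun n => ContinuousMultilinearMap.mkPiRing ℝ _ (c n)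
  have hp (n : ℕ) : p.coeff n = c n := by
    simp [p, FormalMultilinearSeries.coeff]
  have hF : HasFPowerSeriesAt
      (fun s : ℝ => Complex.exp (B * (s : ℂ) ^ m + y * (s : ℂ))) p 0 := by
    rw [hasFPowerSeriesAt_iff]
    refine Filter.Eventually.of_forall fun s => ?_
    simpa only [hp, zero_add] using hasSum_cexp_mul_pow_add m hm B y s
  obtain ⟨r, hr⟩ := hF
  have h := hr.factorial_smul (1 : ℝ) j
  rw [iteratedDeriv_eq_iteratedFDeriv, ← h]
  simp [p, c]

lemma iteratedDeriv_cexp_eval (Q : Polynomial ℂ) (n : ℕ) :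
    ∃ P : Polynomial ℂ, iteratedDeriv n (fun s : ℝ => Complex.exp (Q.eval (s : ℂ))) =
      fun s : ℝ => P.eval (s : ℂ) * Complex.exp (Q.eval (s : ℂ)) := by
  induction n with
  | zero => exact ⟨1, by simp⟩
  | succ n ih =>
    obtain ⟨P, hP⟩ := ih
    refine ⟨P.derivative + P * Q.derivative, ?_⟩
    rw [iteratedDeriv_succ, hP]
    ext s
    have hd := ((P.hasDerivAt (s : ℂ)).mul (Q.hasDerivAt (s : ℂ)).cexp).comp_ofReal
    refine hd.deriv.trans ?_
    simp only [Polynomial.eval_add, Polynomial.eval_mul]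
    ring

lemma exists_bound_eval_mul {F : ℝ → ℂ} {C c : ℝ} (hc : 0 < c)
    (hF : ∀ s, ‖F s‖ ≤ C * Real.exp (-(c * |s|))) (P : Polynomial ℂ) :
    ∃ D : ℝ, ∀ s : ℝ, ‖P.eval (s : ℂ) * F s‖ ≤ D := by
  induction P using Polynomial.induction_on' with
  | add p q hp hq =>
    obtain ⟨D, hD⟩ := hp
    obtain ⟨E, hE⟩ := hq
    refine ⟨D + E, fun s => ?_⟩
    rw [Polynomial.eval_add, add_mul]
    exact (norm_add_le _ _).trans (add_le_add (hD s) (hE s))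
  | monomial n b =>
    refine ⟨‖b‖ * (Nat.factorial n / c ^ n * C), fun s => ?_⟩
    have hpow : |s| ^ n ≤ Nat.factorial n / c ^ n * Real.exp (c * |s|) := by
      have h := Real.pow_div_factorial_le_exp _ (mul_nonneg hc.le (abs_nonneg s)) n
      rw [div_le_iff₀ (by positivity), mul_pow] at h
      rw [div_mul_eq_mul_div, le_div_iff₀ (by positivity)]
      linarith
    rw [Polynomial.eval_monomial, norm_mul, norm_mul, norm_pow, Complex.norm_real,
      Real.norm_eq_abs, mul_assoc]
    refine mul_le_mul_of_nonneg_left ?_ (norm_nonneg b)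
    calc |s| ^ n * ‖F s‖
        ≤ (Nat.factorial n / c ^ n * Real.exp (c * |s|)) * (C * Real.exp (-(c * |s|))) :=
          mul_le_mul hpow (hF s) (norm_nonneg _) (by positivity)
      _ = Nat.factorial n / c ^ n * C * (Real.exp (c * |s|) * Real.exp (-(c * |s|))) := by ring
      _ = Nat.factorial n / c ^ n * C := by rw [← Real.exp_add]; simp

/-- The exponential of a polynomial is a Schwartz function as soon as it decays exponentially. -/
lemma exists_schwartzMap_cexp_eval (Q : Polynomial ℂ) {C c : ℝ} (hc : 0 < c)
    (hQ : ∀ s : ℝ, ‖Complex.exp (Q.eval (s : ℂ))‖ ≤ C * Real.exp (-(c * |s|))) :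
    ∃ f : 𝓢(ℝ, ℂ), ⇑f = fun s : ℝ => Complex.exp (Q.eval (s : ℂ)) := by
  refine ⟨⟨fun s : ℝ => Complex.exp (Q.eval (s : ℂ)), ?_, fun k n => ?_⟩, rfl⟩
  · have hcomp : ContDiff ℝ (⊤ : ℕ∞) fun s : ℝ => Q.eval (s : ℂ) := by
      have h : ContDiff ℂ (⊤ : ℕ∞) fun z : ℂ => Q.eval z := by
        simpa using Q.contDiff_aeval (𝕜 := ℂ) (⊤ : ℕ∞)
      exact (h.restrict_scalars ℝ).comp Complex.ofRealCLM.contDiff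
    exact hcomp.cexp
  · obtain ⟨P, hP⟩ := iteratedDeriv_cexp_eval Q n
    obtain ⟨D, hD⟩ := exists_bound_eval_mul hc hQ (Polynomial.X ^ k * P)
    refine ⟨D, fun s => ?_⟩
    rw [norm_iteratedFDeriv_eq_norm_iteratedDeriv, hP]
    simpa [mul_assoc] using hD s

/-- The moments of the Fourier transform of a Schwartz function are its derivatives at `0`. -/
lemma SchwartzMap.integrable_pow_mul_fourier_and_integral_eq (f : 𝓢(ℝ, ℂ)) (j : ℕ) :
    Integrable (fun y : ℝ => (y : ℂ) ^ j * 𝓕 (f : ℝ → ℂ) y) ∧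
      (2 * Real.pi * Complex.I) ^ j * ∫ y : ℝ, (y : ℂ) ^ j * 𝓕 (f : ℝ → ℂ) y =
        iteratedDeriv j f 0 := by
  have hint : Integrable (fun y : ℝ => (y : ℂ) ^ j * 𝓕 (f : ℝ → ℂ) y) := by
    have hcont : Continuous (𝓕 (f : ℝ → ℂ)) := (𝓕 f).continuous
    refine ((𝓕 f).integrable_pow_mul volume j).mono' ?_ (Filter.Eventually.of_forall fun y => ?_)
    · exact ((Complex.continuous_ofReal.pow j).mul hcont).aestronglyMeasurable
    · simp [SchwartzMap.fourier_coe]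
  refine ⟨hint, ?_⟩
  have hderiv (n : ℕ) : Integrable (iteratedDeriv n f) := by
    have hmeas : Continuous (iteratedDeriv n f) :=
      (f.smooth ⊤).continuous_iteratedDeriv n (mod_cast le_top)
    refine (f.integrable_pow_mul_iteratedFDeriv volume 0 n).mono' hmeas.aestronglyMeasurable
      (Filter.Eventually.of_forall fun y => ?_)
    simp [norm_iteratedFDeriv_eq_norm_iteratedDeriv]
  have hfour : 𝓕 (iteratedDeriv j f) =
      fun y : ℝ => (2 * Real.pi * Complex.I) ^ j * ((y : ℂ) ^ j * 𝓕 (f : ℝ → ℂ) y) := by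
    rw [Real.fourier_iteratedDeriv (N := ⊤) (f.smooth ⊤) (fun n _ => hderiv n) le_top]
    ext y
    rw [smul_eq_mul, mul_pow, mul_assoc]
  have hinv := (hderiv j).fourierInv_fourier_eq (v := 0)
    (by rw [hfour]; exact hint.const_mul _)
    ((f.smooth ⊤).continuous_iteratedDeriv j (mod_cast le_top)).continuousAt
  rw [← hinv, hfour, Real.fourierInv_eq', ← integral_const_mul]
  simp

/-- For even `m ≥ 2`, `a(−1)^{m/2} < 0`, and the higher-order Airy kernel
`K(t,x) = (1/(2π)) ∫ exp(a(iλ)ᵐt + iλx) dλ`: for every `j ∈ ℕ`, `t > 0`, `x ∈ ℝ`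
the function `y ↦ yʲ K(t, x−y)` is integrable and
`∫ K(t, x−y) yʲ dy = j! ∑_{k=0}^{⌊j/m⌋} x^{j−mk} (at)ᵏ/((j−mk)! k!) = H^{(m)}_j(at, x)`. -/
theorem stmt_16 (m : ℕ) (hm_even : Even m) (hm : 2 ≤ m)
    (a : ℝ) (ha : a * (-1 : ℝ) ^ (m / 2) < 0)
    (K : ℝ → ℝ → ℂ)
    (hK : ∀ t x : ℝ, K t x = (1 / (2 * (Real.pi : ℂ))) *
      ∫ l : ℝ, Complex.exp ((a : ℂ) * (Complex.I * (l : ℂ)) ^ m * (t : ℂ)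
        + Complex.I * (l : ℂ) * (x : ℂ))) :
    ∀ (j : ℕ) (t : ℝ), 0 < t → ∀ x : ℝ,
      Integrable (fun y : ℝ => ((y : ℂ)) ^ j * K t (x - y)) ∧
      (∫ y : ℝ, K t (x - y) * ((y : ℂ)) ^ j)
        = (((Nat.factorial j : ℝ) *
            ∑ k ∈ Finset.range (j / m + 1),
              x ^ (j - m * k) * (a * t) ^ k
                / ((Nat.factorial (j - m * k) : ℝ) * (Nat.factorial k : ℝ)) : ℝ) : ℂ) := by
  intro j t ht x
  have hpi := Real.pi_pos
  set w : ℂ := 2 * Real.pi * Complex.I with hw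
  have hw0 : w ≠ 0 := by simp [hw]
  set B : ℂ := a * t * w ^ m with hB
  set y₀ : ℂ := x * w with hy₀
  set d : ℝ := -(a * (-1 : ℝ) ^ (m / 2)) * t * (2 * Real.pi) ^ m with hd
  have hd0 : 0 < d := by
    have : 0 < -(a * (-1 : ℝ) ^ (m / 2)) := neg_pos.mpr ha
    positivity
  have hBd : B = ((-d : ℝ) : ℂ) := by
    have hI : Complex.I ^ m = (-1) ^ (m / 2) := by
      conv_lhs => rw [← Nat.two_mul_div_two_of_even hm_even, pow_mul, Complex.I_sq]
    rw [hB, hw, hd, mul_pow, hI]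
    push_cast
    ring
  let Q : Polynomial ℂ := Polynomial.C B * Polynomial.X ^ m + Polynomial.C y₀ * Polynomial.X
  have hQ (s : ℝ) : Q.eval (s : ℂ) = B * (s : ℂ) ^ m + y₀ * s := by simp [Q]
  obtain ⟨f, hf⟩ := exists_schwartzMap_cexp_eval Q (C := Real.exp d) hd0 (fun s => by
    have hpow : |s| ≤ s ^ m + 1 := by
      rw [← hm_even.pow_abs]
      rcases le_total |s| 1 with h | h
      · linarith [pow_nonneg (abs_nonneg s) m]
      · linarith [le_self_pow₀ h (by lia : m ≠ 0)]
    rw [hQ, Complex.norm_exp, ← Real.exp_add, Real.exp_le_exp]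
    have hre : (B * (s : ℂ) ^ m + y₀ * s).re = -d * s ^ m := by
      rw [hBd, hy₀, hw, Complex.add_re, ← Complex.ofReal_pow, ← Complex.ofReal_mul,
        Complex.ofReal_re]
      simp
    rw [hre]
    nlinarith)
  simp only [hQ] at hf
  have hKf (y : ℝ) : K t (x - y) = 𝓕 (f : ℝ → ℂ) y := by
    rw [hK, Real.fourier_real_eq_integral_exp_smul, hf]
    have hscale := Measure.integral_comp_mul_left (fun l : ℝ =>
      Complex.exp ((a : ℂ) * (Complex.I * (l : ℂ)) ^ m * (t : ℂ)
        + Complex.I * (l : ℂ) * ((x - y : ℝ) : ℂ))) (2 * Real.pi)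
    rw [abs_of_pos (by positivity), Complex.real_smul] at hscale
    push_cast at hscale ⊢
    rw [one_div, ← hscale]
    refine integral_congr_ae (Filter.Eventually.of_forall fun s => ?_)
    simp only [smul_eq_mul]
    rw [← Complex.exp_add, hB, hy₀, hw]
    congr 1
    ring
  obtain ⟨hint, hval⟩ := f.integrable_pow_mul_fourier_and_integral_eq j
  simp only [hKf]
  refine ⟨hint, ?_⟩
  simp only [mul_comm (𝓕 (f : ℝ → ℂ) _)]
  rw [hf, iteratedDeriv_cexp_mul_pow_add_zero m (by lia), ← hf] at hval
  refine mul_left_cancel₀ (pow_ne_zero j hw0) (hval.trans ?_)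
  push_cast
  rw [mul_left_comm, Finset.mul_sum (a := w ^ j)]
  congr 1
  refine Finset.sum_congr rfl fun k hk => ?_
  have hk' : m * k ≤ j := by
    rw [Finset.mem_range, Nat.lt_succ_iff, Nat.le_div_iff_mul_le (by lia)] at hk
    lia
  have hwj : w ^ j = w ^ (j - m * k) * (w ^ m) ^ k := by
    rw [← pow_mul, ← pow_add, Nat.sub_add_cancel hk']
  rw [hwj, hB, hy₀, mul_pow, mul_pow]
  ring
end

section
/- Let m ∈ ℕ be odd with m ≥ 3, let a ∈ ℝ with a ≠ 0, and let x ∈ ℝ. Then the limit lim_{R→∞} (1/(2π)) ∫_{−R}^{R} exp(i·(a·λ^m + λ·x)) dλ exists in ℂ. This limit defines the generalized (higher-order) Airy function of order m at x. -/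
open MeasureTheory Filter

/-- A form of van der Corput's first-derivative test: if the phase `φ` is convex on `[A, ∞)` and
its derivative `ψ` is positive there and tends to infinity, then `∫_A^∞ exp(isφ)` converges for real `s ≠ 0`. -/
theorem exists_tendsto_integral_exp_of_convex_phase {φ ψ χ : ℝ → ℝ} {A s : ℝ} (hs : s ≠ 0)
    (hφ : ∀ t, HasDerivAt φ (ψ t) t) (hψ : ∀ t, HasDerivAt ψ (χ t) t)
    (hpos : ∀ t, A ≤ t → 0 < ψ t) (hconv : ∀ t, A ≤ t → 0 ≤ χ t)
    (hlim : Tendsto ψ atTop atTop) :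
    ∃ L : ℂ, Tendsto (fun R : ℝ => ∫ t in A..R, Complex.exp (s * Complex.I * φ t))
      atTop (nhds L) := by
  have hc : (s * Complex.I : ℂ) ≠ 0 := by simp [hs]
  set E : ℝ → ℂ := fun t => Complex.exp (s * Complex.I * φ t) with hE
  have hnorm : ∀ t, ‖E t‖ = 1 := fun t => by
    simp only [hE]
    rw [show (s * Complex.I * φ t : ℂ) = ((s * φ t : ℝ) : ℂ) * Complex.I by push_cast; ring]
    exact Complex.norm_exp_ofReal_mul_I _
  have hderivE : ∀ t, HasDerivAt E (E t * (s * Complex.I * ψ t)) t := fun t =>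
    ((hφ t).ofReal_comp.const_mul _).cexp
  have hEcont : Continuous E := continuous_iff_continuousAt.2 fun t => (hderivE t).continuousAt
  have hg : ∀ t, A ≤ t → HasDerivAt (fun u => (ψ u)⁻¹) (-χ t / ψ t ^ 2) t := fun t ht =>
    (hψ t).inv (hpos t ht).ne'
  have hglim : Tendsto (fun u => (ψ u)⁻¹) atTop (nhds 0) := hlim.inv_tendsto_atTop
  have hgint : IntegrableOn (fun t => -χ t / ψ t ^ 2) (Set.Ioi A) :=
    integrableOn_Ioi_deriv_of_nonpos' (fun t ht => hg t ht)
      (fun t ht => div_nonpos_of_nonpos_of_nonneg (neg_nonpos.2 (hconv t (le_of_lt ht)))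
        (sq_nonneg _)) hglim
  have hrem : IntegrableOn (fun t => E t * ((-χ t / ψ t ^ 2 : ℝ) : ℂ)) (Set.Ioi A) :=
    hgint.ofReal.bdd_mul hEcont.aestronglyMeasurable (ae_of_all _ fun t => (hnorm t).le)
  have hG : ∀ t, A ≤ t → HasDerivAt (fun u => E u * (((ψ u)⁻¹ : ℝ) : ℂ))
      (s * Complex.I * E t + E t * ((-χ t / ψ t ^ 2 : ℝ) : ℂ)) t := fun t ht => by
    refine ((hderivE t).mul (hg t ht).ofReal_comp).congr_deriv ?_
    have : (ψ t : ℂ) ≠ 0 := by exact_mod_cast (hpos t ht).ne'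
    push_cast
    field_simp
  have hGlim : Tendsto (fun u => E u * (((ψ u)⁻¹ : ℝ) : ℂ)) atTop (nhds 0) := by
    rw [tendsto_zero_iff_norm_tendsto_zero]
    simpa [hnorm] using hglim.abs
  have hlimrem := intervalIntegral_tendsto_integral_Ioi A hrem tendsto_id
  refine ⟨_, Tendsto.congr' ?_
    (((hGlim.sub_const (E A * (((ψ A)⁻¹ : ℝ) : ℂ))).sub hlimrem).const_mul
      (s * Complex.I : ℂ)⁻¹)⟩
  filter_upwards [eventually_ge_atTop A] with R hR
  have hint : IntervalIntegrable (fun t => E t * ((-χ t / ψ t ^ 2 : ℝ) : ℂ)) volume A R :=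
    (intervalIntegrable_iff_integrableOn_Ioc_of_le hR).2 (hrem.mono_set Set.Ioc_subset_Ioi_self)
  have hEint : IntervalIntegrable (fun t => s * Complex.I * E t) volume A R :=
    (continuous_const.mul hEcont).intervalIntegrable _ _
  have hFTC := intervalIntegral.integral_eq_sub_of_hasDerivAt
    (fun t ht => hG t (by rw [Set.uIcc_of_le hR] at ht; exact ht.1)) (hEint.add hint)
  rw [intervalIntegral.integral_add hEint hint, intervalIntegral.integral_const_mul] at hFTC
  rw [← hFTC, id, add_sub_cancel_right, inv_mul_cancel_left₀ hc]

/-- One-sided convergence of the oscillatory integral with phase `s (tᵐ + y t)`. -/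
theorem exists_tendsto_integral_exp_pow_add_mul {m : ℕ} (hm : 2 ≤ m) {s : ℝ} (hs : s ≠ 0) (y : ℝ) :
    ∃ L : ℂ, Tendsto
      (fun R : ℝ => ∫ t in (0 : ℝ)..R,
        Complex.exp (s * Complex.I * ((t ^ m + y * t : ℝ) : ℂ)))
      atTop (nhds L) := by
  have hlim : Tendsto (fun t : ℝ => m * t ^ (m - 1) + y) atTop atTop :=
    tendsto_atTop_add_const_right _ _
      ((tendsto_pow_atTop (by omega)).const_mul_atTop (by positivity))
  obtain ⟨A, hA⟩ := eventually_atTop.1 ((hlim.eventually_gt_atTop 0).and (eventually_ge_atTop 0))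
  obtain ⟨L, hL⟩ := exists_tendsto_integral_exp_of_convex_phase (A := A)
    (φ := fun t => t ^ m + y * t)
    (χ := fun t => m * ((m - 1 : ℕ) * t ^ (m - 1 - 1))) hs
    (fun t => ((hasDerivAt_pow m t).add ((hasDerivAt_id t).const_mul y)).congr_deriv (by simp))
    (fun t => ((hasDerivAt_pow (m - 1) t).const_mul (m : ℝ)).add_const y)
    (fun t ht => (hA t ht).1)
    (fun t ht => by have := (hA t ht).2; positivity) hlim
  have hcont : Continuous fun t : ℝ =>
      Complex.exp (s * Complex.I * ((t ^ m + y * t : ℝ) : ℂ)) := by fun_prop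
  refine ⟨_, (hL.const_add (∫ t in (0 : ℝ)..A,
    Complex.exp (s * Complex.I * ((t ^ m + y * t : ℝ) : ℂ)))).congr fun R => ?_⟩
  exact intervalIntegral.integral_add_adjacent_intervals
    (hcont.intervalIntegrable _ _) (hcont.intervalIntegrable _ _)

/-- For odd `m ≥ 3`, real `a ≠ 0` and `x ∈ ℝ`, the improper oscillatory integral
`lim_{R→∞} (1/(2π)) ∫_{−R}^{R} exp(i(aλᵐ + λx)) dλ` exists in `ℂ`; it defines the
generalized (higher-order) Airy function of order `m` at `x`. -/
theorem stmt_17 (m : ℕ) (hm_odd : Odd m) (hm : 3 ≤ m) (a : ℝ) (ha : a ≠ 0) (x : ℝ) :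
    ∃ L : ℂ, Tendsto
      (fun R : ℝ => (1 / (2 * (Real.pi : ℂ))) *
        ∫ l : ℝ in (-R)..R,
          Complex.exp (Complex.I * ((a : ℂ) * (l : ℂ) ^ m + (l : ℂ) * (x : ℂ))))
      atTop (nhds L) := by
  obtain ⟨L₁, h₁⟩ := exists_tendsto_integral_exp_pow_add_mul (by omega : 2 ≤ m) ha (x / a)
  obtain ⟨L₂, h₂⟩ := exists_tendsto_integral_exp_pow_add_mul (by omega : 2 ≤ m)
    (neg_ne_zero.2 ha) (x / a)
  have haC : (a : ℂ) ≠ 0 := by exact_mod_cast ha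
  set f : ℝ → ℂ := fun l =>
    Complex.exp (Complex.I * ((a : ℂ) * (l : ℂ) ^ m + (l : ℂ) * (x : ℂ))) with hf
  have hcont : Continuous f := by fun_prop
  have hright : ∀ t : ℝ,
      Complex.exp (a * Complex.I * ((t ^ m + x / a * t : ℝ) : ℂ)) = f t := fun t => by
    rw [hf]
    congr 1
    push_cast
    field_simp
  have hleft : ∀ t : ℝ,
      Complex.exp ((-a : ℝ) * Complex.I * ((t ^ m + x / a * t : ℝ) : ℂ)) = f (-t) := fun t => by
    rw [hf]
    congr 1
    push_cast
    rw [hm_odd.neg_pow]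
    field_simp
    ring
  simp only [hright] at h₁
  simp only [hleft] at h₂
  refine ⟨_, ((h₂.add h₁).const_mul (1 / (2 * (Real.pi : ℂ)))).congr fun R => ?_⟩
  rw [intervalIntegral.integral_comp_neg, neg_zero,
    intervalIntegral.integral_add_adjacent_intervals
      (hcont.intervalIntegrable _ _) (hcont.intervalIntegrable _ _)]
end
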